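/- For every ε > 0 there exists q₀ such that for every prime q ≥ q₀ there exists an integer k with 1 ≤ k ≤ q−1 satisfying −C(−k) = C(k) ≥ (e^γ/4 − ε) log log q, where γ is the Euler–Mascheroni constant. -/

import Mathlib

open scoped Classical Real
open Complex MeasureTheory

/-- The sawtooth function `ψ`. -/
noncomputable def saw (x : ℝ) : ℝ := if Int.fract x = 0 then 0 else Int.fract x - 1/2

/-- The Euler product `A_{q,χ}`. -/
noncomputable def Aq (q : ℕ) (χ : DirichletCharacter ℂ q) : ℂ :=
  ∏' p : Nat.Primes, if (p : ℕ) ∣ q then 1 else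
    1 - (1 - χ ((p : ℕ) : ZMod q)) ^ 2 / (((p : ℕ) : ℂ) - 1) ^ 2

/-- The quantity `C(k) = C(k; q)` (a real number; we take the real part of the
defining expression, which is real). -/
noncomputable def Cfun (q : ℕ) (k : ℤ) : ℝ :=
  if h : q = 0 then 0 else
    haveI : NeZero q := ⟨h⟩
    ((↑q.totient : ℂ)⁻¹ *
      ∑ χ ∈ Finset.univ.filter (fun χ : DirichletCharacter ℂ q => χ ≠ 1),
        (starRingEnd ℂ) (χ ((k : ZMod q))) * DirichletCharacter.LFunction χ 0 *
          DirichletCharacter.LFunction χ 1 * Aq q χ).re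

/-- The sawtooth function `x ↦ ψ(x / q)` on `ZMod q`. -/
noncomputable def sawZ {q : ℕ} (x : ZMod q) : ℝ := if x = 0 then 0 else (x.val : ℝ) / q - 1 / 2

lemma sawZ_zero {q : ℕ} : sawZ (0 : ZMod q) = 0 := by simp [sawZ]

lemma sawZ_neg {q : ℕ} [NeZero q] (x : ZMod q) : sawZ (-x) = -sawZ x := by
  by_cases hx : x = 0
  · simp [hx, sawZ_zero]
  · have hq : (q : ℝ) ≠ 0 := Nat.cast_ne_zero.mpr (NeZero.ne q)
    have hlt := (ZMod.val_lt x).le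
    simp only [sawZ, neg_eq_zero, hx, if_false, ZMod.neg_val]
    push_cast [Nat.cast_sub hlt]
    field_simp
    ring

lemma abs_sawZ_le {q : ℕ} [NeZero q] (x : ZMod q) : |sawZ x| ≤ 1 / 2 := by
  have hq : (0 : ℝ) < q := Nat.cast_pos.mpr (NeZero.pos q)
  by_cases hx : x = 0
  · simp [hx, sawZ_zero]
  · simp only [sawZ, hx, if_false]
    have h1 : (x.val : ℝ) / q ≤ 1 := by
      rw [div_le_one hq]; exact_mod_cast (ZMod.val_lt x).le
    have h0 : 0 ≤ (x.val : ℝ) / q := by positivity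
    rw [abs_le]; constructor <;> linarith

lemma sum_eq_zero_of_odd {q : ℕ} [NeZero q] {R : Type*} [AddCommGroup R] [IsAddTorsionFree R]
    {f : ZMod q → R} (hf : ∀ x, f (-x) = -f x) : ∑ x, f x = 0 := by
  have h : ∑ x, f x = -∑ x, f x := by
    rw [← Finset.sum_neg_distrib]
    exact Fintype.sum_equiv (Equiv.neg _) _ _ fun x => by simp [hf]
  exact self_eq_neg.mp h

lemma sum_sawZ {q : ℕ} [NeZero q] : ∑ x : ZMod q, sawZ x = 0 := sum_eq_zero_of_odd sawZ_neg

lemma sum_range_mul_pow {z : ℂ} (hz : z ≠ 1) (n : ℕ) :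
    ∑ i ∈ Finset.range n, (i : ℂ) * z ^ i =
      n * z ^ n / (z - 1) - z * (z ^ n - 1) / (z - 1) ^ 2 := by
  have h1 : z - 1 ≠ 0 := sub_ne_zero.mpr hz
  induction n with
  | zero => simp
  | succ n ih =>
    rw [Finset.sum_range_succ, ih]
    push_cast
    field_simp
    ring

lemma sum_zmod_eq_sum_range {q : ℕ} [NeZero q] {R : Type*} [AddCommMonoid R] (f : ZMod q → R) :
    ∑ x, f x = ∑ i ∈ Finset.range q, f (i : ZMod q) := by
  refine (Finset.sum_bij' (s := Finset.range q) (t := Finset.univ) (f := fun i => f (i : ZMod q))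
    (g := f) (fun (i : ℕ) _ => (i : ZMod q)) (fun (x : ZMod q) _ => x.val) ?_ ?_ ?_ ?_ ?_).symm
  · simp
  · intro x _; simpa using ZMod.val_lt x
  · intro i hi; exact ZMod.val_cast_of_lt (by simpa using hi)
  · intro x _; simp
  · simp

lemma sum_sawZ_mul_stdAddChar {q : ℕ} [NeZero q] {y : ZMod q} (hy : y ≠ 0) :
    ∑ x : ZMod q, (sawZ x : ℂ) * ZMod.stdAddChar (-(x * y)) =
      I / 2 * Complex.cot (π * (y.val / q : ℝ)) := by
  have hq : (q : ℂ) ≠ 0 := Nat.cast_ne_zero.mpr (NeZero.ne q)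
  set z : ℂ := ZMod.stdAddChar (-y) with hz
  have hz1 : z ≠ 1 := by
    intro h
    apply hy
    have := ZMod.injective_stdAddChar (N := q) (a₁ := -y) (a₂ := 0) (by simpa using h)
    simpa using this
  have hzq : z ^ q = 1 := by
    rw [hz, ← AddChar.map_nsmul_eq_pow]
    simp
  have hpow (i : ℕ) : (ZMod.stdAddChar (-((i : ZMod q) * y)) : ℂ) = z ^ i := by
    rw [hz, ← AddChar.map_nsmul_eq_pow]
    simp
  have hs : ∑ x : ZMod q, (sawZ x : ℂ) * ZMod.stdAddChar (-(x * y)) =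
      ∑ i ∈ Finset.range q, (((i : ℂ) / q - 1 / 2) * z ^ i) + 1 / 2 := by
    rw [sum_zmod_eq_sum_range]
    obtain ⟨n, rfl⟩ : ∃ n, q = n + 1 := ⟨q - 1, by have := NeZero.pos q; omega⟩
    rw [Finset.sum_range_succ', Finset.sum_range_succ']
    have : ∀ i ∈ Finset.range n, ((sawZ (((i + 1 : ℕ)) : ZMod (n + 1)) : ℝ) : ℂ) *
        ZMod.stdAddChar (-((((i + 1 : ℕ)) : ZMod (n + 1)) * y)) =
        ((((i + 1 : ℕ) : ℂ)) / ((n + 1 : ℕ) : ℂ) - 1 / 2) * z ^ (i + 1) := by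
      intro i hi
      have hi' : i + 1 < n + 1 := by simpa using hi
      rw [hpow]
      congr 1
      have hv : (((i + 1 : ℕ)) : ZMod (n + 1)).val = i + 1 := ZMod.val_cast_of_lt hi'
      have h0 : (((i + 1 : ℕ)) : ZMod (n + 1)) ≠ 0 := by
        intro h; rw [h] at hv; simp at hv
      simp only [sawZ, h0, if_false, hv]
      push_cast
      ring
    rw [Finset.sum_congr rfl this]
    simp [sawZ_zero]
  have h1 : z - 1 ≠ 0 := sub_ne_zero.mpr hz1
  have hs2 : ∑ i ∈ Finset.range q, (((i : ℂ) / q - 1 / 2) * z ^ i) + 1 / 2 =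
      (z + 1) / (2 * (z - 1)) := by
    have : ∑ i ∈ Finset.range q, (((i : ℂ) / q - 1 / 2) * z ^ i) =
        (∑ i ∈ Finset.range q, (i : ℂ) * z ^ i) / q - 1 / 2 * ∑ i ∈ Finset.range q, z ^ i := by
      rw [Finset.sum_div, Finset.mul_sum, ← Finset.sum_sub_distrib]
      exact Finset.sum_congr rfl fun i _ => by ring
    rw [this, sum_range_mul_pow hz1, geom_sum_eq hz1, hzq]
    field_simp
    ring
  rw [hs, hs2]
  set θ : ℂ := π * (y.val / q : ℝ) with hθ
  have hzθ : z = (Complex.exp (2 * I * θ))⁻¹ := by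
    rw [hz, ← Complex.exp_neg]
    have : -y = ((-(y.val : ℤ) : ℤ) : ZMod q) := by simp
    rw [this, ZMod.stdAddChar_coe]
    congr 1
    rw [hθ]
    push_cast
    ring
  have he : Complex.exp (2 * I * θ) ≠ 0 := Complex.exp_ne_zero _
  rw [Complex.cot_eq_exp_ratio]
  rw [hzθ] at h1 ⊢
  set E := Complex.exp (2 * I * θ)
  have hE1 : E - 1 ≠ 0 := by
    intro h
    apply h1
    rw [sub_eq_zero.mp h]; simp
  have hE2 : 1 - E ≠ 0 := by
    intro h
    apply hE1
    linear_combination -h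
  field_simp
  ring

/-- The series `∑ (1 / (n + a) - 1 / (n + 1))`. -/
noncomputable def digammaSeries (a : ℝ) : ℝ := ∑' n : ℕ, (1 / (n + a) - 1 / (n + 1))

lemma inv_rpow_sub_inv_rpow_bound {r s : ℝ} (hr : 0 < r) (hr1 : r ≤ 1) (hs1 : 1 ≤ s) (hs2 : s ≤ 2)
    (n : ℕ) : ‖1 / ((n : ℝ) + r) ^ s - 1 / ((n : ℝ) + 1) ^ s‖ ≤ 2 / r ^ 2 * (1 / ((n : ℝ) + 1) ^ 2) := by
  set u : ℝ := n + r with hu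
  set v : ℝ := n + 1 with hv
  have hn : (0 : ℝ) ≤ n := n.cast_nonneg
  have hu0 : 0 < u := by positivity
  have hv0 : 0 < v := by positivity
  have huv : u ≤ v := by linarith
  have hru : r ≤ u := by linarith
  have hrv : r * v ≤ u := by nlinarith
  have h1 : u * r ≤ u ^ s := by
    have : u ^ s = u * u ^ (s - 1) := by
      rw [Real.rpow_sub_one hu0.ne']; field_simp
    rw [this]
    gcongr
    calc r = r ^ (1 : ℝ) := (Real.rpow_one r).symm
      _ ≤ r ^ (s - 1) := Real.rpow_le_rpow_of_exponent_ge hr hr1 (by linarith)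
      _ ≤ u ^ (s - 1) := Real.rpow_le_rpow hr.le hru (by linarith)
  have h2 : (u / v) ^ 2 ≤ (u / v) ^ s := by
    rw [← Real.rpow_natCast]
    exact Real.rpow_le_rpow_of_exponent_ge (by positivity) (by rw [div_le_one hv0]; exact huv)
      (by simpa using hs2)
  have h3 : 0 ≤ 1 / u ^ s - 1 / v ^ s := by
    rw [sub_nonneg]
    gcongr
  rw [Real.norm_of_nonneg h3]
  have h4 : 1 / u ^ s - 1 / v ^ s = 1 / u ^ s * (1 - (u / v) ^ s) := by
    rw [Real.div_rpow hu0.le hv0.le]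
    have := (Real.rpow_pos_of_pos hu0 s).ne'
    field_simp
  have h5 : (u / v) ≤ 1 := by rw [div_le_one hv0]; exact huv
  have h50 : 0 ≤ u / v := by positivity
  calc 1 / u ^ s - 1 / v ^ s = 1 / u ^ s * (1 - (u / v) ^ s) := h4
    _ ≤ 1 / (u * r) * (2 * (1 - u / v)) := by
        have h6 : (u / v) ^ s ≤ 1 := Real.rpow_le_one h50 h5 (by linarith)
        gcongr
        nlinarith [sq_nonneg (1 - u / v)]
    _ = 2 * (v - u) / (u * r * v) := by field_simp
    _ ≤ 2 * 1 / ((r * v) * r * v) := by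
        gcongr
        linarith
    _ = 2 / r ^ 2 * (1 / v ^ 2) := by field_simp

lemma summable_inv_add_one_sq (c : ℝ) : Summable fun n : ℕ => c * (1 / ((n : ℝ) + 1) ^ 2) := by
  apply Summable.mul_left
  have := (summable_nat_add_iff (f := fun n : ℕ => 1 / (n : ℝ) ^ 2) 1).mpr
    (Real.summable_one_div_nat_pow.mpr (by norm_num))
  simpa using this

lemma summable_digammaSeries {a : ℝ} (ha : 0 < a) (ha1 : a ≤ 1) :
    Summable fun n : ℕ => 1 / ((n : ℝ) + a) - 1 / (n + 1) := by
  refine Summable.of_norm_bounded (summable_inv_add_one_sq (2 / a ^ 2)) fun n => ?_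
  simpa using inv_rpow_sub_inv_rpow_bound ha ha1 le_rfl one_le_two n

lemma le_digammaSeries {a : ℝ} (ha : 0 < a) (ha1 : a ≤ 1) : 1 / a - 1 ≤ digammaSeries a := by
  have h := (summable_digammaSeries ha ha1).sum_le_tsum {0} (fun n _ => by
    rw [sub_nonneg]
    have : (0 : ℝ) ≤ n := n.cast_nonneg
    gcongr)
  simpa [digammaSeries] using h

lemma digammaSeries_le {a : ℝ} (ha : 0 < a) (ha1 : a ≤ 1) : digammaSeries a ≤ 1 / a := by
  have key (N : ℕ) : ∑ n ∈ Finset.range (N + 1), (1 / ((n : ℝ) + a) - 1 / (n + 1)) ≤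
      1 / a - 1 / (N + 1) := by
    induction N with
    | zero => simp
    | succ N ih =>
      rw [Finset.sum_range_succ]
      have hN : (0 : ℝ) ≤ N := N.cast_nonneg
      have : 1 / (((N + 1 : ℕ) : ℝ) + a) ≤ 1 / ((N : ℝ) + 1) := by
        push_cast
        exact one_div_le_one_div_of_le (by positivity) (by linarith)
      push_cast at *
      linarith
  refine le_of_tendsto' ((summable_digammaSeries ha ha1).hasSum.tendsto_sum_nat.comp
    (Filter.tendsto_add_atTop_nat 1)) fun N => (key N).trans ?_
  have : (0 : ℝ) ≤ 1 / (N + 1) := by positivity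
  linarith

lemma digammaSeries_sub {a : ℝ} (ha : 0 < a) (ha1 : a < 1) :
    ((digammaSeries a - digammaSeries (1 - a) : ℝ) : ℂ) = π * Complex.cot (π * a) := by
  have hb : 0 < 1 - a := by linarith
  have hS := (summable_digammaSeries ha ha1.le).hasSum.sub
    (summable_digammaSeries hb (by linarith)).hasSum
  have hc : (a : ℂ) ∈ Complex.integerComplement := by
    rw [Complex.mem_integerComplement_iff]
    rintro ⟨n, hn⟩
    have hn' : (n : ℝ) = a := by exact_mod_cast hn
    have h0 : (0 : ℤ) < n := by exact_mod_cast hn' ▸ ha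
    have h1 : n < (1 : ℤ) := by exact_mod_cast hn' ▸ ha1
    omega
  have hcot := tendsto_logDeriv_euler_cot_sub hc
  have hT : Filter.Tendsto (fun N : ℕ => (((1 / a - 1 / (a + N)) : ℝ) : ℂ) +
      ∑ n ∈ Finset.range N, (1 / ((a : ℂ) - (n + 1)) + 1 / (a + (n + 1)))) Filter.atTop
      (nhds (((1 / a - 0 : ℝ) : ℂ) + (π * Complex.cot (π * a) - 1 / a))) := by
    refine Filter.Tendsto.add ?_ hcot
    refine (Complex.continuous_ofReal.tendsto _).comp ?_
    refine tendsto_const_nhds.sub ?_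
    simp_rw [one_div]
    exact (Filter.tendsto_atTop_add_const_left _ _ tendsto_natCast_atTop_atTop).inv_tendsto_atTop
  have hT2 := (Complex.continuous_ofReal.tendsto _).comp hS.tendsto_sum_nat
  have heq : (fun N : ℕ => (((1 / a - 1 / (a + N)) : ℝ) : ℂ) +
      ∑ n ∈ Finset.range N, (1 / ((a : ℂ) - (n + 1)) + 1 / (a + (n + 1)))) =
      (fun x : ℝ => (x : ℂ)) ∘ fun N => ∑ i ∈ Finset.range N,
        (1 / ((i : ℝ) + a) - 1 / (i + 1) - (1 / ((i : ℝ) + (1 - a)) - 1 / (i + 1))) := by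
    funext N
    have : (((1 / a - 1 / (a + N)) : ℝ) : ℂ) +
      ∑ n ∈ Finset.range N, (1 / ((a : ℂ) - (n + 1)) + 1 / (a + (n + 1))) =
      (((1 / a - 1 / (a + N)) + ∑ n ∈ Finset.range N,
        (1 / (a - (n + 1)) + 1 / (a + (n + 1))) : ℝ) : ℂ) := by push_cast; rfl
    rw [this]
    simp only [Function.comp]
    congr 1
    induction N with
    | zero => simp
    | succ N ih =>
      have h1 : 1 / (a - (N + 1)) = -(1 / ((N : ℝ) + (1 - a))) := by
        rw [← neg_sub ((N : ℝ) + 1), ← one_div_neg_eq_neg_one_div]; congr 1; ring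
      have := ih (by push_cast; rfl)
      rw [Finset.sum_range_succ, Finset.sum_range_succ, ← this, h1]
      push_cast
      ring
  rw [heq] at hT
  have := tendsto_nhds_unique hT2 hT
  rw [digammaSeries, digammaSeries, this]
  push_cast
  ring

/-- Representative in `(0, 1]` of `x / q`. -/
noncomputable def unitRep {q : ℕ} (x : ZMod q) : ℝ := if x = 0 then 1 else (x.val : ℝ) / q

lemma unitRep_pos {q : ℕ} [NeZero q] (x : ZMod q) : 0 < unitRep x := by
  unfold unitRep
  split_ifs with h
  · exact one_pos
  · have : 0 < x.val := Nat.pos_of_ne_zero (by simpa [ZMod.val_eq_zero] using h)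
    have hq : 0 < q := NeZero.pos q
    positivity

lemma unitRep_le_one {q : ℕ} [NeZero q] (x : ZMod q) : unitRep x ≤ 1 := by
  unfold unitRep
  split_ifs with h
  · exact le_rfl
  · rw [div_le_one (by exact_mod_cast NeZero.pos q)]
    exact_mod_cast (ZMod.val_lt x).le

lemma coe_unitRep {q : ℕ} [NeZero q] (x : ZMod q) :
    ((unitRep x : ℝ) : UnitAddCircle) = ZMod.toAddCircle x := by
  unfold unitRep
  split_ifs with h
  · simp [h]
  · exact (ZMod.toAddCircle_apply x).symm

/-- Weights computing `L(Φ, 1)` for functions `Φ` on `ZMod q` of sum zero. -/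
noncomputable def lam {q : ℕ} (x : ZMod q) : ℝ := (1 + digammaSeries (unitRep x)) / q

lemma LFunction_one_eq_sum {q : ℕ} [NeZero q] {Φ : ZMod q → ℂ} (hΦ : ∑ x, Φ x = 0) :
    ZMod.LFunction Φ 1 = ∑ x, Φ x * (lam x : ℂ) := by
  have hq : (q : ℂ) ≠ 0 := Nat.cast_ne_zero.mpr (NeZero.ne q)
  have hcast : Filter.Tendsto (fun s : ℝ => (s : ℂ)) (nhdsWithin 1 (Set.Ioi 1)) (nhds 1) := by
    have := (Complex.continuous_ofReal.tendsto 1).mono_left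
      (nhdsWithin_le_nhds (s := Set.Ioi (1 : ℝ)))
    simpa using this
  have hlim := ((ZMod.differentiable_LFunction_of_sum_zero hΦ).continuous.tendsto 1).comp hcast
  refine tendsto_nhds_unique hlim ?_
  have hform : ∀ᶠ s : ℝ in nhdsWithin (1 : ℝ) (Set.Ioi 1),
      (q : ℂ) ^ (-(s : ℂ)) * ∑ x, Φ x * ((∑' n : ℕ, (1 / ((n : ℝ) + unitRep x) ^ s -
        1 / ((n : ℝ) + 1) ^ s) : ℝ) : ℂ) = (ZMod.LFunction Φ ∘ fun s : ℝ => (s : ℂ)) s := by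
    filter_upwards [self_mem_nhdsWithin] with s hs
    have hs' : 1 < (s : ℂ).re := by simpa using hs
    simp only [Function.comp, ZMod.LFunction]
    congr 1
    have h1 : HasSum (fun n : ℕ => 1 / ((n : ℂ) + ((1 : ℝ) : ℂ)) ^ (s : ℂ))
        (HurwitzZeta.hurwitzZeta ((1 : ℝ) : UnitAddCircle) s) :=
      HurwitzZeta.hasSum_hurwitzZeta_of_one_lt_re (by simp) hs'
    have hx (x : ZMod q) : ((∑' n : ℕ, (1 / ((n : ℝ) + unitRep x) ^ s -
        1 / ((n : ℝ) + 1) ^ s) : ℝ) : ℂ) = HurwitzZeta.hurwitzZeta (ZMod.toAddCircle x) s -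
        HurwitzZeta.hurwitzZeta ((1 : ℝ) : UnitAddCircle) s := by
      have h2 : HasSum (fun n : ℕ => 1 / ((n : ℂ) + (unitRep x : ℂ)) ^ (s : ℂ))
        (HurwitzZeta.hurwitzZeta ((unitRep x : ℝ) : UnitAddCircle) s) :=
        HurwitzZeta.hasSum_hurwitzZeta_of_one_lt_re
          ⟨(unitRep_pos x).le, unitRep_le_one x⟩ hs'
      rw [← coe_unitRep, ← (h2.sub h1).tsum_eq, Complex.ofReal_tsum]
      refine tsum_congr fun n => ?_
      have hp := unitRep_pos x
      have h3 : (0 : ℝ) ≤ (n : ℝ) + unitRep x := by positivity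
      have h4 : (0 : ℝ) ≤ (n : ℝ) + 1 := by positivity
      push_cast [Complex.ofReal_cpow h3, Complex.ofReal_cpow h4]
      rfl
    simp_rw [hx, mul_sub]
    rw [Finset.sum_sub_distrib, ← Finset.sum_mul, hΦ]
    simp
  refine Filter.Tendsto.congr' hform ?_
  have hgoal : ∑ x, Φ x * (lam x : ℂ) =
      (q : ℂ) ^ (-(1 : ℂ)) * ∑ x, Φ x * ((∑' n : ℕ, (1 / ((n : ℝ) + unitRep x) ^ (1 : ℝ) -
        1 / ((n : ℝ) + 1) ^ (1 : ℝ)) : ℝ) : ℂ) := by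
    simp only [Real.rpow_one, Complex.cpow_neg_one]
    have : ∀ x, Φ x * (lam x : ℂ) =
        (q : ℂ)⁻¹ * Φ x + (q : ℂ)⁻¹ * (Φ x * (digammaSeries (unitRep x) : ℂ)) := by
      intro x
      simp only [lam]
      push_cast
      ring
    simp_rw [this]
    rw [Finset.sum_add_distrib, ← Finset.mul_sum, hΦ, mul_zero, zero_add, ← Finset.mul_sum]
    rfl
  rw [hgoal]
  refine Filter.Tendsto.mul ?_ (tendsto_finsetSum _ fun x _ => tendsto_const_nhds.mul ?_)
  · exact hcast.neg.const_cpow (Or.inl hq)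
  · refine (Complex.continuous_ofReal.tendsto _).comp ?_
    refine tendsto_tsum_of_dominated_convergence
      (summable_inv_add_one_sq (2 / unitRep x ^ 2)) (fun n => ?_) ?_
    · have hp := unitRep_pos x
      have h3 : (n : ℝ) + unitRep x ≠ 0 := by positivity
      have h4 : (n : ℝ) + 1 ≠ 0 := by positivity
      have hid : Filter.Tendsto (fun s : ℝ => s) (nhdsWithin 1 (Set.Ioi 1)) (nhds 1) :=
        nhdsWithin_le_nhds
      refine Filter.Tendsto.sub ?_ ?_
      · refine tendsto_const_nhds.div (tendsto_const_nhds.rpow hid (Or.inl h3)) ?_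
        simpa using h3
      · refine tendsto_const_nhds.div (tendsto_const_nhds.rpow hid (Or.inl h4)) ?_
        simpa using h4
    · have : Set.Ioc (1 : ℝ) 2 ∈ nhdsWithin (1 : ℝ) (Set.Ioi 1) :=
        Ioc_mem_nhdsGT (by norm_num)
      filter_upwards [this] with s hs n
      exact inv_rpow_sub_inv_rpow_bound (unitRep_pos x) (unitRep_le_one x) hs.1.le hs.2 n

lemma inv_val_le_lam {q : ℕ} [NeZero q] {x : ZMod q} (hx : x ≠ 0) :
    1 / (x.val : ℝ) ≤ lam x := by
  have hq : (0 : ℝ) < q := Nat.cast_pos.mpr (NeZero.pos q)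
  have h := le_digammaSeries (unitRep_pos x) (unitRep_le_one x)
  have h2 : 1 / unitRep x = q * (1 / (x.val : ℝ)) := by
    simp only [unitRep, hx, if_false]; field_simp
  rw [lam, le_div_iff₀ hq]
  linarith

lemma lam_le_inv_val {q : ℕ} [NeZero q] {x : ZMod q} (hx : x ≠ 0) :
    lam x ≤ 1 / (x.val : ℝ) + 1 / q := by
  have hq : (0 : ℝ) < q := Nat.cast_pos.mpr (NeZero.pos q)
  have h := digammaSeries_le (unitRep_pos x) (unitRep_le_one x)
  have h2 : 1 / unitRep x = q * (1 / (x.val : ℝ)) := by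
    simp only [unitRep, hx, if_false]; field_simp
  rw [lam, div_le_iff₀ hq, add_mul, one_div_mul_cancel hq.ne']
  linarith

lemma lam_sub_lam_neg {q : ℕ} [NeZero q] {x : ZMod q} (hx : x ≠ 0) :
    ((lam x - lam (-x) : ℝ) : ℂ) = π / q * Complex.cot (π * (x.val / q : ℝ)) := by
  have hq : (0 : ℝ) < q := Nat.cast_pos.mpr (NeZero.pos q)
  have hx' : 0 < x.val := Nat.pos_of_ne_zero (by simpa [ZMod.val_eq_zero] using hx)
  have h1 : unitRep x = (x.val : ℝ) / q := by simp [unitRep, hx]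
  have h2 : unitRep (-x) = 1 - (x.val : ℝ) / q := by
    simp only [unitRep, neg_eq_zero, hx, if_false, ZMod.neg_val]
    push_cast [Nat.cast_sub (ZMod.val_lt x).le]
    field_simp
  have h3 := digammaSeries_sub (a := (x.val : ℝ) / q) (by positivity)
    (by rw [div_lt_one hq]; exact_mod_cast ZMod.val_lt x)
  have : ((lam x - lam (-x) : ℝ) : ℂ) = ((digammaSeries ((x.val : ℝ) / q) -
      digammaSeries (1 - (x.val : ℝ) / q) : ℝ) : ℂ) / q := by
    simp only [lam, h1, h2]
    push_cast
    ring
  rw [this, h3]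
  ring

/-- Discrete Fourier transform of the sawtooth function. -/
noncomputable def sawHat {q : ℕ} [NeZero q] (y : ZMod q) : ℂ :=
  ∑ x : ZMod q, (sawZ x : ℂ) * ZMod.stdAddChar (-(x * y))

lemma sawHat_zero {q : ℕ} [NeZero q] : sawHat (0 : ZMod q) = 0 := by
  simp only [sawHat, mul_zero, neg_zero, AddChar.map_zero_eq_one, mul_one]
  rw [← Complex.ofReal_sum, sum_sawZ, Complex.ofReal_zero]

lemma sum_stdAddChar_mul {q : ℕ} [NeZero q] (b : ZMod q) :
    ∑ x : ZMod q, (ZMod.stdAddChar (x * b) : ℂ) = if b = 0 then (q : ℂ) else 0 := by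
  have := AddChar.sum_mulShift b (ZMod.isPrimitive_stdAddChar q)
  rw [this]
  split_ifs <;> simp [ZMod.card]

lemma sum_sawHat_mul_stdAddChar {q : ℕ} [NeZero q] (j : ZMod q) :
    ∑ y : ZMod q, sawHat y * ZMod.stdAddChar (j * y) = q * sawZ j := by
  simp only [sawHat, Finset.sum_mul]
  rw [Finset.sum_comm]
  have (x : ZMod q) : ∑ y : ZMod q, (sawZ x : ℂ) * ZMod.stdAddChar (-(x * y)) *
      ZMod.stdAddChar (j * y) = if x = j then (q : ℂ) * sawZ x else 0 := by
    have h (y : ZMod q) : (sawZ x : ℂ) * ZMod.stdAddChar (-(x * y)) * ZMod.stdAddChar (j * y) =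
        sawZ x * ZMod.stdAddChar (y * (j - x)) := by
      rw [mul_assoc, ← AddChar.map_add_eq_mul]
      congr 2
      ring
    simp_rw [h]
    rw [← Finset.mul_sum, sum_stdAddChar_mul]
    simp only [sub_eq_zero, eq_comm (a := j)]
    split_ifs <;> ring
  simp_rw [this]
  simp

lemma hurwitzZetaOdd_toAddCircle_zero {q : ℕ} [NeZero q] (j : ZMod q) :
    HurwitzZeta.hurwitzZetaOdd (ZMod.toAddCircle j) 0 = -sawZ j := by
  by_cases hj : j = 0
  · have h := HurwitzZeta.hurwitzZetaOdd_neg (0 : UnitAddCircle) 0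
    rw [neg_zero] at h
    rw [hj, map_zero, sawZ_zero, self_eq_neg.mp h]
    simp
  have h1 : HurwitzZeta.hurwitzZetaOdd (ZMod.toAddCircle j) 0 =
      HurwitzZeta.sinZeta (ZMod.toAddCircle j) 1 / π := by
    have := HurwitzZeta.hurwitzZetaOdd_one_sub (ZMod.toAddCircle j) (s := 1) (fun n h => by
      have h' : ((1 : ℝ) : ℂ) = ((-(n : ℝ) : ℝ) : ℂ) := by push_cast; exact h
      have h2 : (1 : ℝ) = -(n : ℝ) := Complex.ofReal_injective h'
      have : (0 : ℝ) ≤ n := n.cast_nonneg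
      linarith)
    rw [sub_self, Complex.Gamma_one, Complex.cpow_neg_one, mul_one (π : ℂ),
      Complex.sin_pi_div_two] at this
    rw [this]
    have : (π : ℂ) ≠ 0 := Complex.ofReal_ne_zero.mpr Real.pi_ne_zero
    field_simp
  have hL (i : ZMod q) (hi : i ≠ 0) : HurwitzZeta.expZeta (ZMod.toAddCircle i) 1 =
      ∑ y : ZMod q, ZMod.stdAddChar (i * y) * (lam y : ℂ) := by
    rw [← ZMod.LFunction_stdAddChar_eq_expZeta i 1 (Or.inl hi), LFunction_one_eq_sum]
    simp_rw [mul_comm i]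
    rw [sum_stdAddChar_mul, if_neg hi]
  have h2 : 2 * I * HurwitzZeta.sinZeta (ZMod.toAddCircle j) 1 =
      ∑ y : ZMod q, ZMod.stdAddChar (j * y) * ((lam y - lam (-y) : ℝ) : ℂ) := by
    have e1 : 2 * I * HurwitzZeta.sinZeta (ZMod.toAddCircle j) 1 =
        HurwitzZeta.expZeta (ZMod.toAddCircle j) 1 -
          HurwitzZeta.expZeta (ZMod.toAddCircle (-j)) 1 := by
      simp only [HurwitzZeta.expZeta, map_neg, HurwitzZeta.sinZeta_neg, HurwitzZeta.cosZeta_neg]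
      ring
    rw [e1, hL j hj, hL (-j) (neg_ne_zero.mpr hj)]
    have e2 : ∑ y : ZMod q, ZMod.stdAddChar (-j * y) * (lam y : ℂ) =
        ∑ y : ZMod q, ZMod.stdAddChar (j * y) * (lam (-y) : ℂ) :=
      Fintype.sum_equiv (Equiv.neg _) _ _ fun y => by simp
    rw [e2, ← Finset.sum_sub_distrib]
    refine Finset.sum_congr rfl fun y _ => ?_
    push_cast
    ring
  have h3 (y : ZMod q) : ((lam y - lam (-y) : ℝ) : ℂ) = -2 * I * π / q * sawHat y := by
    by_cases hy : y = 0
    · simp [hy, sawHat_zero]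
    · rw [lam_sub_lam_neg hy, sawHat, sum_sawZ_mul_stdAddChar hy]
      linear_combination ((π : ℂ) / q * Complex.cot (π * (y.val / q : ℝ))) * Complex.I_sq
  have h4 : 2 * I * HurwitzZeta.sinZeta (ZMod.toAddCircle j) 1 = -2 * I * π * sawZ j := by
    have hq : (q : ℂ) ≠ 0 := Nat.cast_ne_zero.mpr (NeZero.ne q)
    rw [h2]
    have : ∀ y : ZMod q, ZMod.stdAddChar (j * y) * ((lam y - lam (-y) : ℝ) : ℂ) =
        -2 * I * π / q * (sawHat y * ZMod.stdAddChar (j * y)) := fun y => by rw [h3]; ring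
    simp_rw [this]
    rw [← Finset.mul_sum, sum_sawHat_mul_stdAddChar]
    field_simp
  rw [h1]
  have : (π : ℂ) ≠ 0 := Complex.ofReal_ne_zero.mpr Real.pi_ne_zero
  have hI : I ≠ 0 := Complex.I_ne_zero
  rw [div_eq_iff this]
  have h5 : (2 * I) ≠ 0 := by simp
  apply mul_left_cancel₀ h5
  rw [h4]; ring

lemma LFunction_zero_of_odd {q : ℕ} [NeZero q] {Φ : ZMod q → ℂ} (hΦ : Function.Odd Φ) :
    ZMod.LFunction Φ 0 = -∑ x, Φ x * (sawZ x : ℂ) := by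
  rw [ZMod.LFunction_def_odd hΦ, neg_zero, Complex.cpow_zero, one_mul, ← Finset.sum_neg_distrib]
  refine Finset.sum_congr rfl fun x _ => ?_
  rw [hurwitzZetaOdd_toAddCircle_zero]
  ring

lemma LFunction_zero_eq_sum {q : ℕ} [NeZero q] (hq : q ≠ 1) (χ : DirichletCharacter ℂ q) :
    DirichletCharacter.LFunction χ 0 = -∑ x, χ x * (sawZ x : ℂ) := by
  rcases χ.even_or_odd with h | h
  · rw [sum_eq_zero_of_odd (fun x => by rw [h.eval_neg, sawZ_neg]; push_cast; ring)]
    rw [DirichletCharacter.LFunction, ZMod.LFunction_apply_zero_of_even h.to_fun]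
    have : Nontrivial (ZMod q) := ZMod.nontrivial_iff.mpr hq
    simp [χ.map_nonunit not_isUnit_zero]
  · exact LFunction_zero_of_odd h.to_fun

lemma LFunction_one_eq_sum_char {q : ℕ} [NeZero q] (χ : DirichletCharacter ℂ q) (hχ : χ ≠ 1) :
    DirichletCharacter.LFunction χ 1 = ∑ x, χ x * (lam x : ℂ) :=
  LFunction_one_eq_sum (MulChar.sum_eq_zero_of_ne_one hχ)

/-- Finite Fourier transform of a function of Dirichlet characters. -/
noncomputable def charHat {q : ℕ} [NeZero q] (w : DirichletCharacter ℂ q → ℂ) (k : ZMod q) : ℂ :=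
  (q.totient : ℂ)⁻¹ * ∑ χ : DirichletCharacter ℂ q, χ k⁻¹ * w χ

/-- The factor at `p` of the Euler product `A_{q,χ}`. -/
noncomputable def AqFactor {q : ℕ} (χ : DirichletCharacter ℂ q) (p : ℕ) : ℂ :=
  if p ∣ q then 1 else 1 - (1 - χ (p : ZMod q)) ^ 2 / ((p : ℂ) - 1) ^ 2

/-- The value `-L(0,χ) L(1,χ)` for `χ ≠ 1`, and `0` for `χ = 1`. -/
noncomputable def negLL {q : ℕ} [NeZero q] (χ : DirichletCharacter ℂ q) : ℂ :=
  (∑ b, χ b * (sawZ b : ℂ)) * ∑ a, χ a * (lam a : ℂ)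

/-- The inverse transform of `L(0,χ) L(1,χ)`. -/
noncomputable def dedSum {q : ℕ} [NeZero q] (k : ZMod q) : ℝ := -∑ a, lam a * sawZ (k * a⁻¹)

section
variable {q : ℕ} [Fact q.Prime]

lemma charHat_sub (v w : DirichletCharacter ℂ q → ℂ) (k : ZMod q) :
    charHat (fun χ => v χ - w χ) k = charHat v k - charHat w k := by
  simp only [charHat, mul_sub, Finset.sum_sub_distrib]

lemma charHat_add (v w : DirichletCharacter ℂ q → ℂ) (k : ZMod q) :
    charHat (fun χ => v χ + w χ) k = charHat v k + charHat w k := by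
  simp only [charHat, mul_add, Finset.sum_add_distrib]

lemma charHat_const_mul (c : ℂ) (w : DirichletCharacter ℂ q → ℂ) (k : ZMod q) :
    charHat (fun χ => c * w χ) k = c * charHat w k := by
  simp only [charHat, mul_left_comm _ c, ← Finset.mul_sum]

lemma charHat_sum {ι : Type*} (s : Finset ι) (w : ι → DirichletCharacter ℂ q → ℂ) (k : ZMod q) :
    charHat (fun χ => ∑ i ∈ s, w i χ) k = ∑ i ∈ s, charHat (w i) k := by
  simp only [charHat, Finset.mul_sum]
  rw [Finset.sum_comm]

lemma charHat_char_mul (b : ZMod q) (w : DirichletCharacter ℂ q → ℂ) (k : ZMod q) :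
    charHat (fun χ => χ b * w χ) k = charHat w (k * b⁻¹) := by
  simp only [charHat, mul_inv, inv_inv, map_mul, mul_assoc]

lemma charHat_negLL {k : ZMod q} (hk : k ≠ 0) : charHat negLL k = -(dedSum k : ℂ) := by
  have hφ : (q.totient : ℂ) ≠ 0 := by
    exact_mod_cast (Nat.totient_pos.mpr (NeZero.pos q)).ne'
  have h1 : ∀ χ : DirichletCharacter ℂ q, χ k⁻¹ * negLL χ =
      ∑ a, ∑ b, (lam a : ℂ) * sawZ b * (χ k⁻¹ * χ (a * b)) := by
    intro χ
    simp only [negLL, Finset.sum_mul_sum]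
    rw [Finset.sum_comm]
    simp only [Finset.mul_sum]
    refine Finset.sum_congr rfl fun a _ => Finset.sum_congr rfl fun b _ => ?_
    rw [map_mul]; ring
  simp only [charHat, h1]
  rw [Finset.sum_comm]
  simp_rw [Finset.sum_comm (s := (Finset.univ : Finset (DirichletCharacter ℂ q))),
    ← Finset.mul_sum, DirichletCharacter.sum_char_inv_mul_char_eq ℂ (isUnit_iff_ne_zero.mpr hk)]
  simp only [dedSum, neg_neg, Complex.ofReal_sum, Complex.ofReal_neg]
  rw [Finset.mul_sum]
  refine Finset.sum_congr rfl fun a _ => ?_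
  by_cases ha : a = 0
  · simp [ha, hk, sawZ_zero]
  · rw [Finset.sum_eq_single (k * a⁻¹)]
    · rw [if_pos (by field_simp)]
      push_cast
      field_simp
    · intro b _ hb
      rw [if_neg, mul_zero]
      rintro rfl
      apply hb
      field_simp
    · simp

lemma negLL_one : negLL (1 : DirichletCharacter ℂ q) = 0 := by
  have : ∑ b : ZMod q, (1 : DirichletCharacter ℂ q) b * (sawZ b : ℂ) = 0 :=
    sum_eq_zero_of_odd fun x => by
      rw [sawZ_neg, ← neg_one_mul, map_mul, MulChar.one_apply isUnit_one.neg]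
      push_cast
      ring
  rw [negLL, this, zero_mul]

lemma Cfun_eq (k : ℤ) :
    Cfun q k = -(charHat (fun χ => Aq q χ * negLL χ) (k : ZMod q)).re := by
  have hq : q ≠ 1 := (Fact.out : q.Prime).ne_one
  have hq0 : q ≠ 0 := (Fact.out : q.Prime).ne_zero
  rw [Cfun, dif_neg hq0, ← Complex.neg_re, charHat, ← mul_neg, ← Finset.sum_neg_distrib]
  congr 2
  rw [Finset.sum_filter]
  refine Finset.sum_congr rfl fun χ _ => ?_
  split_ifs with h
  · rw [LFunction_zero_eq_sum hq, LFunction_one_eq_sum_char χ h, negLL]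
    have : (starRingEnd ℂ) (χ (k : ZMod q)) = χ (k : ZMod q)⁻¹ := by
      rw [starRingEnd_apply, MulChar.star_apply', MulChar.inv_apply']
    rw [this]; ring
  · rw [not_not.mp h, negLL_one]; simp

lemma norm_charHat_mul_sub_one_le {w : DirichletCharacter ℂ q → ℂ} {B : ℝ} {p : ℕ}
    (hpp : p.Prime) (hw : ∀ k : ZMod q, k ≠ 0 → ‖charHat w k‖ ≤ B) {k : ZMod q} (hk : k ≠ 0) :
    ‖charHat (fun χ => (AqFactor χ p - 1) * w χ) k‖ ≤ 4 * (1 / ((p : ℝ) - 1) ^ 2) * B := by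
  have hB : 0 ≤ B := (norm_nonneg _).trans (hw k hk)
  by_cases hp : p ∣ q
  · have : charHat (fun χ : DirichletCharacter ℂ q => (AqFactor χ p - 1) * w χ) k = 0 := by
      simp [charHat, AqFactor, hp]
    rw [this, norm_zero]
    positivity
  · have hp0 : (p : ZMod q) ≠ 0 := by
      rw [Ne, ZMod.natCast_eq_zero_iff]
      exact fun h => hp ((Nat.prime_dvd_prime_iff_eq Fact.out hpp).mp h ▸ dvd_rfl)
    have h1 : charHat (fun χ => (AqFactor χ p - 1) * w χ) k =
        -(1 / ((p : ℂ) - 1) ^ 2) * (charHat w k - 2 * charHat w (k * (p : ZMod q)⁻¹) +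
          charHat w (k * (p : ZMod q)⁻¹ * (p : ZMod q)⁻¹)) := by
      rw [← charHat_char_mul, ← charHat_char_mul, ← charHat_char_mul, ← charHat_const_mul,
        ← charHat_sub, ← charHat_add, ← charHat_const_mul]
      congr 1
      funext χ
      simp only [AqFactor, if_neg hp]
      ring
    have h2 : k * (p : ZMod q)⁻¹ ≠ 0 := mul_ne_zero hk (inv_ne_zero hp0)
    have h3 := hw _ hk
    have h4 := hw _ h2
    have h5 := hw _ (mul_ne_zero h2 (inv_ne_zero hp0))
    have h6 : ‖-(1 / ((p : ℂ) - 1) ^ 2)‖ = 1 / ((p : ℝ) - 1) ^ 2 := by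
      have : -(1 / ((p : ℂ) - 1) ^ 2) = ((-(1 / ((p : ℝ) - 1) ^ 2) : ℝ) : ℂ) := by push_cast; rfl
      rw [this, Complex.norm_real, norm_neg, Real.norm_of_nonneg (by positivity)]
    rw [h1, norm_mul, h6, mul_comm (4 : ℝ), mul_assoc _ 4 B]
    refine mul_le_mul_of_nonneg_left ?_ (by positivity)
    refine (norm_add_le _ _).trans ?_
    have := norm_sub_le (charHat w k) (2 * charHat w (k * (p : ZMod q)⁻¹))
    rw [norm_mul, Complex.norm_ofNat] at this
    linarith

lemma norm_charHat_prod_sub_le {w : DirichletCharacter ℂ q → ℂ} {B : ℝ} {S : Finset ℕ}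
    (hS : ∀ p ∈ S, p.Prime) (hw : ∀ k : ZMod q, k ≠ 0 → ‖charHat w k‖ ≤ B) {k : ZMod q} (hk : k ≠ 0) :
    ‖charHat (fun χ => (∏ p ∈ S, AqFactor χ p) * w χ) k - charHat w k‖ ≤
      B * (Real.exp (4 * ∑ p ∈ S, 1 / ((p : ℝ) - 1) ^ 2) - 1) := by
  have hB : 0 ≤ B := (norm_nonneg _).trans (hw k hk)
  induction S using Finset.induction_on generalizing k with
  | empty => simp
  | insert p S hp ih =>
    have hS' : ∀ p ∈ S, p.Prime := fun p hp => hS p (Finset.mem_insert_of_mem hp)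
    set E := Real.exp (4 * ∑ p ∈ S, 1 / ((p : ℝ) - 1) ^ 2) with hE
    have h1 : ∀ k : ZMod q, k ≠ 0 →
        ‖charHat (fun χ => (∏ p ∈ S, AqFactor χ p) * w χ) k‖ ≤ B * E := by
      intro k hk
      have := norm_le_norm_add_norm_sub' (charHat (fun χ => (∏ p ∈ S, AqFactor χ p) * w χ) k)
        (charHat w k)
      linarith [ih hS' hk, hw k hk]
    have h2 := norm_charHat_mul_sub_one_le (hS p (Finset.mem_insert_self p S)) h1 hk
    have h3 : charHat (fun χ => (∏ p ∈ insert p S, AqFactor χ p) * w χ) k - charHat w k =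
        (charHat (fun χ => (∏ p ∈ S, AqFactor χ p) * w χ) k - charHat w k) +
        charHat (fun χ => (AqFactor χ p - 1) * ((∏ p ∈ S, AqFactor χ p) * w χ)) k := by
      rw [← charHat_sub, ← charHat_sub, ← charHat_add]
      congr 1
      funext χ
      rw [Finset.prod_insert hp]
      ring
    rw [h3, Finset.sum_insert hp, mul_add, Real.exp_add]
    refine (norm_add_le _ _).trans ((add_le_add (ih hS' hk) h2).trans ?_)
    have h4 := Real.add_one_le_exp (4 * (1 / ((p : ℝ) - 1) ^ 2))
    have h5 : 0 ≤ B * E := mul_nonneg hB (Real.exp_pos _).le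
    nlinarith
end

lemma charHat_neg_of_odd {q : ℕ} [Fact q.Prime] (w : DirichletCharacter ℂ q → ℂ) (k : ZMod q) :
    charHat (fun χ => w χ * negLL χ) (-k) = -charHat (fun χ => w χ * negLL χ) k := by
  simp only [charHat]
  rw [← mul_neg, ← Finset.sum_neg_distrib]
  congr 1
  refine Finset.sum_congr rfl fun χ _ => ?_
  rcases χ.even_or_odd with h | h
  · have : negLL χ = 0 := by
      rw [negLL, sum_eq_zero_of_odd (fun x => by rw [h.eval_neg, sawZ_neg]; push_cast; ring),
        zero_mul]
    simp [this]
  · rw [inv_neg, h.eval_neg]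
    ring

lemma Cfun_neg {q : ℕ} [Fact q.Prime] (k : ℤ) : Cfun q (-k) = -Cfun q k := by
  rw [Cfun_eq, Cfun_eq, Int.cast_neg, charHat_neg_of_odd, Complex.neg_re]

/-- The inclusion of the set of primes in `ℕ`. -/
def primesEmbedding : Nat.Primes ↪ ℕ := ⟨fun p => p, Nat.Primes.coe_nat_injective⟩

lemma sum_one_div_sub_one_sq_le {N : ℕ} (hN : 2 ≤ N) {T : Finset ℕ} (hT : ∀ n ∈ T, N ≤ n) :
    ∑ n ∈ T, 1 / ((n : ℝ) - 1) ^ 2 ≤ 2 / ((N : ℝ) - 1) := by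
  have hN' : (2 : ℝ) ≤ N := by exact_mod_cast hN
  have key (m : ℕ) : ∑ n ∈ Finset.Ico N (N + m), 1 / ((n : ℝ) - 1) ^ 2 ≤
      2 / ((N : ℝ) - 1) - 2 / ((N + m : ℕ) - 1 : ℝ) := by
    induction m with
    | zero => simp
    | succ m ih =>
      rw [← add_assoc, Finset.sum_Ico_succ_top (by omega)]
      have hm : (0 : ℝ) ≤ m := m.cast_nonneg
      push_cast at ih ⊢
      have h0 : (0 : ℝ) < N + m - 1 := by linarith
      have h1 : (0 : ℝ) < N + m := by linarith
      have : 1 / ((N : ℝ) + m - 1) ^ 2 ≤ 2 / ((N : ℝ) + m - 1) - 2 / (N + m + 1 - 1) := by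
        have : 2 / ((N : ℝ) + m - 1) - 2 / (N + m + 1 - 1) = 2 / ((N + m - 1) * (N + m)) := by
          have : (N : ℝ) + m + 1 - 1 = N + m := by ring
          rw [this]
          field_simp
          ring
        rw [this, div_le_div_iff₀ (by positivity) (by positivity)]
        nlinarith
      linarith
  have hsub : T ⊆ Finset.Ico N (N + (T.sup id + 1)) := by
    intro n hn
    have := Finset.le_sup (f := id) hn
    simp only [id] at this
    rw [Finset.mem_Ico]
    exact ⟨hT n hn, by omega⟩
  refine (Finset.sum_le_sum_of_subset_of_nonneg hsub fun n _ _ => by positivity).trans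
    ((key _).trans ?_)
  have : (0 : ℝ) ≤ 2 / ((N + (T.sup id + 1) : ℕ) - 1 : ℝ) := by
    apply div_nonneg (by norm_num)
    push_cast
    have : (0 : ℝ) ≤ (T.sup id : ℕ) := Nat.cast_nonneg _
    linarith
  linarith

lemma norm_AqFactor_sub_one_le {q : ℕ} (χ : DirichletCharacter ℂ q) (p : ℕ) :
    ‖AqFactor χ p - 1‖ ≤ 4 * (1 / ((p : ℝ) - 1) ^ 2) := by
  rw [AqFactor]
  split_ifs
  · rw [sub_self, norm_zero]; positivity
  · have h6 : ‖((p : ℂ) - 1) ^ 2‖ = ((p : ℝ) - 1) ^ 2 := by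
      have : ((p : ℂ) - 1) ^ 2 = ((((p : ℝ) - 1) ^ 2 : ℝ) : ℂ) := by push_cast; rfl
      rw [this, Complex.norm_real, Real.norm_of_nonneg (by positivity)]
    have h7 : ‖1 - χ (p : ZMod q)‖ ≤ 2 := by
      refine (norm_sub_le _ _).trans ?_
      have := χ.norm_le_one (p : ZMod q)
      rw [norm_one]
      linarith
    rw [sub_sub_cancel_left, norm_neg, norm_div, h6, norm_pow, mul_one_div]
    gcongr
    nlinarith [norm_nonneg (1 - χ (p : ZMod q))]

lemma tendsto_prod_AqFactor {q : ℕ} (χ : DirichletCharacter ℂ q) :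
    Filter.Tendsto (fun S : Finset Nat.Primes =>
      ∏ p ∈ S.map primesEmbedding, AqFactor χ p) Filter.atTop (nhds (Aq q χ)) := by
  have hs : Summable fun p : Nat.Primes => ‖AqFactor χ p - 1‖ := by
    refine summable_of_sum_le (c := 8) (fun _ => norm_nonneg _) fun S => ?_
    have h := sum_one_div_sub_one_sq_le le_rfl (T := S.map primesEmbedding)
      (fun n hn => by
        obtain ⟨p, _, rfl⟩ := Finset.mem_map.mp hn
        exact p.2.two_le)
    rw [Finset.sum_map] at h
    refine (Finset.sum_le_sum fun (p : Nat.Primes) _ => norm_AqFactor_sub_one_le χ (p : ℕ)).trans ?_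
    rw [← Finset.mul_sum]
    have h' : ∑ p ∈ S, 1 / (((p : ℕ) : ℝ) - 1) ^ 2 ≤ 2 / ((2 : ℕ) - 1 : ℝ) := h
    norm_num at h' ⊢
    linarith
  have hm := (multipliable_one_add_of_summable hs).hasProd
  simp only [add_sub_cancel] at hm
  simp only [Finset.prod_map]
  rw [HasProd, SummationFilter.unconditional_filter] at hm
  exact hm

lemma sum_inv_val_le {q : ℕ} [NeZero q] :
    ∑ a : ZMod q, (1 / (a.val : ℝ)) ≤ 1 + Real.log q := by
  rw [sum_zmod_eq_sum_range]
  have h1 : ∀ i ∈ Finset.range q, 1 / (((i : ZMod q).val : ℕ) : ℝ) = 1 / (i : ℝ) := by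
    intro i hi
    rw [ZMod.val_cast_of_lt (by simpa using hi)]
  rw [Finset.sum_congr rfl h1]
  obtain ⟨n, hn⟩ : ∃ n, q = n + 1 := ⟨q - 1, by have := NeZero.pos q; omega⟩
  have h2 := harmonic_le_one_add_log n
  have h3 : ∑ i ∈ Finset.range q, 1 / (i : ℝ) = (harmonic n : ℝ) := by
    rw [hn, Finset.sum_range_succ', harmonic]
    push_cast
    simp
  rw [h3]
  refine h2.trans ?_
  rcases Nat.eq_zero_or_pos n with h | h
  · simp [h, hn]
  · have : Real.log n ≤ Real.log q := Real.log_le_log (by exact_mod_cast h) (by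
      rw [hn]; push_cast; linarith)
    linarith

section
variable {q : ℕ} [Fact q.Prime]

lemma abs_dedSum_le (k : ZMod q) : |dedSum k| ≤ (2 + Real.log q) / 2 := by
  have hq : (0 : ℝ) < q := Nat.cast_pos.mpr (NeZero.pos q)
  rw [dedSum, abs_neg]
  refine (Finset.abs_sum_le_sum_abs _ _).trans ?_
  have h : ∀ a : ZMod q, |lam a * sawZ (k * a⁻¹)| ≤ (1 / (a.val : ℝ) + 1 / q) / 2 := by
    intro a
    by_cases ha : a = 0
    · rw [ha, inv_zero, mul_zero, sawZ_zero, mul_zero, abs_zero]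
      positivity
    · have h1 := inv_val_le_lam ha
      have h0 : 0 ≤ 1 / (a.val : ℝ) := by positivity
      rw [abs_mul, abs_of_nonneg (h0.trans h1)]
      have := mul_le_mul (lam_le_inv_val ha) (abs_sawZ_le (k * a⁻¹)) (abs_nonneg _) (by positivity)
      linarith
  refine (Finset.sum_le_sum fun a _ => h a).trans ?_
  rw [← Finset.sum_div, Finset.sum_add_distrib]
  have h2 : ∑ _a : ZMod q, 1 / (q : ℝ) = 1 := by
    rw [Finset.sum_const, Finset.card_univ, ZMod.card, nsmul_eq_mul]
    field_simp
  rw [h2]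
  have := sum_inv_val_le (q := q)
  linarith

lemma le_Cfun {y : ℕ} (hy : 2 ≤ y) {k : ℤ} (hk : (k : ZMod q) ≠ 0) :
    -(charHat (fun χ => (∏ p ∈ y.primesBelow, AqFactor χ p) * negLL χ) (k : ZMod q)).re -
      (2 + Real.log q) / 2 * Real.exp 8 * (Real.exp (8 / ((y : ℝ) - 1)) - 1) ≤ Cfun q k := by
  have hB : ∀ k : ZMod q, k ≠ 0 → ‖charHat negLL k‖ ≤ (2 + Real.log q) / 2 := by
    intro k hk
    rw [charHat_negLL hk, norm_neg, Complex.norm_real]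
    exact abs_dedSum_le k
  have hB0 : 0 ≤ (2 + Real.log q) / 2 := (norm_nonneg _).trans (hB 1 one_ne_zero)
  have hP : ∀ p ∈ y.primesBelow, p.Prime := fun p hp => Nat.prime_of_mem_primesBelow hp
  have hB2 : ∀ k : ZMod q, k ≠ 0 →
      ‖charHat (fun χ => (∏ p ∈ y.primesBelow, AqFactor χ p) * negLL χ) k‖ ≤
        (2 + Real.log q) / 2 * Real.exp 8 := by
    intro k hk
    have h1 := norm_charHat_prod_sub_le hP hB hk
    have h2 := hB k hk
    have h3 := norm_le_norm_add_norm_sub' (charHat (fun χ =>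
      (∏ p ∈ y.primesBelow, AqFactor χ p) * negLL χ) k) (charHat negLL k)
    have h4 : Real.exp (4 * ∑ p ∈ y.primesBelow, 1 / ((p : ℝ) - 1) ^ 2) ≤ Real.exp 8 := by
      apply Real.exp_le_exp.mpr
      have := sum_one_div_sub_one_sq_le le_rfl (T := y.primesBelow) fun p hp => (hP p hp).two_le
      norm_num at this ⊢
      linarith
    have h5 := mul_le_mul_of_nonneg_left h4 hB0
    linarith
  have hlim : Filter.Tendsto (fun S : Finset Nat.Primes =>
      -(charHat (fun χ => (∏ p ∈ S.map primesEmbedding, AqFactor χ p) * negLL χ)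
        (k : ZMod q)).re) Filter.atTop (nhds (Cfun q k)) := by
    rw [Cfun_eq]
    refine ((Complex.continuous_re.tendsto _).comp ?_).neg
    refine tendsto_const_nhds.mul (tendsto_finsetSum _ fun χ _ => ?_)
    exact tendsto_const_nhds.mul ((tendsto_prod_AqFactor χ).mul tendsto_const_nhds)
  refine ge_of_tendsto hlim ?_
  filter_upwards [Filter.eventually_ge_atTop (y.primesBelow.subtype Nat.Prime)] with S hS
  set T := S.map primesEmbedding with hT
  have hPT : y.primesBelow ⊆ T := by
    intro p hp
    rw [hT, Finset.mem_map]
    exact ⟨⟨p, hP p hp⟩, hS (by simpa using hp), rfl⟩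
  have hTp : ∀ p ∈ T, p.Prime := by
    intro p hp
    obtain ⟨p', _, rfl⟩ := Finset.mem_map.mp hp
    exact p'.2
  have h1 := norm_charHat_prod_sub_le (S := T \ y.primesBelow)
    (fun p hp => hTp p (Finset.mem_sdiff.mp hp).1) hB2 hk
  have h2 : (fun χ : DirichletCharacter ℂ q => (∏ p ∈ T \ y.primesBelow, AqFactor χ p) *
      ((∏ p ∈ y.primesBelow, AqFactor χ p) * negLL χ)) =
      fun χ => (∏ p ∈ T, AqFactor χ p) * negLL χ := by
    funext χ
    rw [← mul_assoc, Finset.prod_sdiff hPT]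
  rw [h2] at h1
  have h3 : Real.exp (4 * ∑ p ∈ T \ y.primesBelow, 1 / ((p : ℝ) - 1) ^ 2) ≤
      Real.exp (8 / ((y : ℝ) - 1)) := by
    apply Real.exp_le_exp.mpr
    have := sum_one_div_sub_one_sq_le hy (T := T \ y.primesBelow) (fun p hp => by
      rw [Finset.mem_sdiff] at hp
      by_contra! h
      exact hp.2 (Nat.mem_primesBelow.mpr ⟨h, hTp p hp.1⟩))
    calc _ ≤ 4 * (2 / ((y : ℝ) - 1)) := by linarith
      _ = _ := by ring
  have h4 := mul_le_mul_of_nonneg_left h3 (mul_nonneg hB0 (Real.exp_pos 8).le)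
  have h5 := (Complex.abs_re_le_norm _).trans h1
  rw [Complex.sub_re] at h5
  have h6 := (abs_le.mp h5).2
  linarith
end

lemma sum_val_mul_le {m : ℕ} [NeZero m] (x : ZMod m) (n : ℕ) :
    2 * ∑ j ∈ Finset.range n, (x * (j : ZMod m)).val ≤ n * m + 2 * m ^ 2 := by
  have hper : 2 * ∑ j ∈ Finset.range m, (x * (j : ZMod m)).val ≤ m * m := by
    rw [← sum_zmod_eq_sum_range (fun y : ZMod m => (x * y).val), two_mul]
    have h1 : ∑ y : ZMod m, (x * y).val = ∑ y : ZMod m, (-(x * y)).val :=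
      Fintype.sum_equiv (Equiv.neg _) _ _ fun y => by simp
    nth_rewrite 2 [h1]
    rw [← Finset.sum_add_distrib]
    refine (Finset.sum_le_card_nsmul _ _ m fun y _ => ?_).trans (by simp [ZMod.card])
    rw [ZMod.neg_val]
    have := ZMod.val_lt (x * y)
    split_ifs with h
    · simp [h]
    · omega
  induction n using Nat.strong_induction_on with
  | _ n ih =>
    rcases lt_or_ge n m with h | h
    · have : ∑ j ∈ Finset.range n, (x * (j : ZMod m)).val ≤ n * m := by
        refine (Finset.sum_le_card_nsmul _ _ m fun y _ => (ZMod.val_lt _).le).trans (by simp)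
      nlinarith
    · obtain ⟨n', rfl⟩ := Nat.exists_eq_add_of_le h
      have hm := NeZero.pos m
      have h1 := ih n' (by omega)
      rw [Finset.sum_range_add]
      have h2 : ∀ j ∈ Finset.range n', (x * ((m + j : ℕ) : ZMod m)).val =
          (x * (j : ZMod m)).val := fun j _ => by simp
      rw [Finset.sum_congr rfl h2]
      nlinarith

/-- Minus the average of the sawtooth function over the multiples `K b, 2 K b, …, J K b`. -/
noncomputable def negAvgSaw {q : ℕ} (K J : ℕ) (b : ZMod q) : ℝ :=
  -((J : ℝ)⁻¹ * ∑ j ∈ Finset.Icc 1 J, sawZ (((K * j : ℕ) : ZMod q) * b))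

section
variable {q : ℕ} [Fact q.Prime]

lemma sawZ_mul_inv {m n : ℕ} (hm : 0 < m) (hmq : m < q) (hn : 0 < n) (hnq : n < q) :
    sawZ ((n : ZMod q) * (m : ZMod q)⁻¹) =
      n / (m * q) + (-(n : ZMod m) * (q : ZMod m)⁻¹).val / m - 1 / 2 := by
  have hq : 0 < q := NeZero.pos q
  have : NeZero m := ⟨hm.ne'⟩
  have hcast {a : ℕ} (ha : 0 < a) (haq : a < q) : (a : ZMod q) ≠ 0 := by
    rw [Ne, ZMod.natCast_eq_zero_iff]
    exact fun h => absurd (Nat.le_of_dvd ha h) (by omega)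
  have hm0 := hcast hm hmq
  have hn0 := hcast hn hnq
  have hx0 : (n : ZMod q) * (m : ZMod q)⁻¹ ≠ 0 := mul_ne_zero hn0 (inv_ne_zero hm0)
  set v := ((n : ZMod q) * (m : ZMod q)⁻¹).val with hv
  have hvq : v < q := ZMod.val_lt _
  have hv0 : 0 < v := Nat.pos_of_ne_zero (by rw [hv, Ne, ZMod.val_eq_zero]; exact hx0)
  have hdvd : (q : ℤ) ∣ (v : ℤ) * m - n := by
    rw [← ZMod.intCast_zmod_eq_zero_iff_dvd]
    push_cast
    rw [hv, ZMod.natCast_zmod_val, inv_mul_cancel_right₀ hm0, sub_self]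
  obtain ⟨t, ht⟩ := hdvd
  have hnq' : (n : ℤ) < q := by exact_mod_cast hnq
  have hvq' : (v : ℤ) + 1 ≤ q := by exact_mod_cast hvq
  have hn' : (0 : ℤ) < n := by exact_mod_cast hn
  have hm' : (0 : ℤ) < m := by exact_mod_cast hm
  have hv' : (0 : ℤ) < v := by exact_mod_cast hv0
  have hq' : (0 : ℤ) < q := by exact_mod_cast hq
  have ht0 : 0 ≤ t := by
    by_contra! h
    nlinarith [mul_pos hv' hm']
  have htm : t < m := by
    by_contra! h
    nlinarith
  obtain ⟨s, rfl⟩ := Int.eq_ofNat_of_zero_le ht0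
  have hsm : s < m := by exact_mod_cast htm
  have hcop : IsUnit (q : ZMod m) := by
    rw [ZMod.isUnit_iff_coprime]
    exact ((Fact.out : q.Prime).coprime_iff_not_dvd.mpr
      fun h => absurd (Nat.le_of_dvd hm h) (by omega))
  have hs : -(n : ZMod m) * (q : ZMod m)⁻¹ = (s : ZMod m) := by
    have h1 : ((v : ℤ) * m - n : ℤ) = ((q : ZMod m) * s) := by
      rw [ht]; push_cast; ring
    push_cast at h1
    rw [CharP.cast_eq_zero (ZMod m) m, mul_zero, zero_sub] at h1
    rw [h1, mul_comm (q : ZMod m), mul_assoc, ZMod.mul_inv_of_unit _ hcop, mul_one]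
  rw [hs, ZMod.val_cast_of_lt hsm, sawZ, if_neg hx0, ← hv]
  have ht' : (v : ℝ) * m = n + q * s := by
    have : (v : ℤ) * m = n + q * s := by linarith
    exact_mod_cast this
  have hqR : (0 : ℝ) < q := by exact_mod_cast hq
  have hmR : (0 : ℝ) < m := by exact_mod_cast hm
  field_simp
  linarith

lemma sum_sawZ_mul_inv_le {m K J : ℕ} (hm : 0 < m) (hmq : m < q) (hK : 0 < K) (hKJ : K * J < q)
    {x : ZMod m} (hx : x = -(K : ZMod m) * (q : ZMod m)⁻¹) :
    ∑ j ∈ Finset.Icc 1 J, sawZ (((K * j : ℕ) : ZMod q) * (m : ZMod q)⁻¹) ≤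
      J * (K * J / q) + (∑ j ∈ Finset.Icc 1 J, ((x * (j : ZMod m)).val : ℝ)) / m - J / 2 := by
  have hqR : (0 : ℝ) < q := by exact_mod_cast NeZero.pos q
  have hmR : (1 : ℝ) ≤ m := by exact_mod_cast hm
  have h : ∀ j ∈ Finset.Icc 1 J, sawZ (((K * j : ℕ) : ZMod q) * (m : ZMod q)⁻¹) ≤
      (K * J / q : ℝ) + ((x * (j : ZMod m)).val : ℝ) / m - 1 / 2 := by
    intro j hj
    rw [Finset.mem_Icc] at hj
    have hle : K * j ≤ K * J := Nat.mul_le_mul_left K hj.2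
    rw [sawZ_mul_inv hm hmq (Nat.mul_pos hK hj.1) (by omega)]
    have h1 : -((K * j : ℕ) : ZMod m) * (q : ZMod m)⁻¹ = x * j := by
      rw [hx]; push_cast; ring
    rw [h1]
    have h2 : ((K * j : ℕ) : ℝ) / (m * q) ≤ (K * J / q : ℝ) := by
      have : ((K * j : ℕ) : ℝ) ≤ K * J := by exact_mod_cast hle
      gcongr
      nlinarith
    linarith
  refine (Finset.sum_le_sum h).trans (le_of_eq ?_)
  rw [Finset.sum_sub_distrib, Finset.sum_add_distrib, Finset.sum_div]
  simp only [Finset.sum_const, Nat.card_Icc, add_tsub_cancel_right, nsmul_eq_mul]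
  ring

lemma negAvgSaw_inv_ge {m K J : ℕ} (hm : 0 < m) (hmq : m < q) (hK : 0 < K) (hJ : 0 < J)
    (hKJ : K * J < q) : -(K * J / q + 2 * m / J : ℝ) ≤ negAvgSaw K J (m : ZMod q)⁻¹ := by
  have : NeZero m := ⟨hm.ne'⟩
  have hJR : (0 : ℝ) < J := by exact_mod_cast hJ
  have hmR : (1 : ℝ) ≤ m := by exact_mod_cast hm
  have h1 := sum_sawZ_mul_inv_le hm hmq hK hKJ rfl
  set x := -(K : ZMod m) * (q : ZMod m)⁻¹
  have h2 := sum_val_mul_le x (J + 1)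
  rw [Finset.sum_range_succ'] at h2
  have h3 : ∑ j ∈ Finset.Icc 1 J, ((x * (j : ZMod m)).val : ℝ) =
      ((∑ j ∈ Finset.range J, (x * ((j + 1 : ℕ) : ZMod m)).val : ℕ) : ℝ) := by
    rw [Finset.range_eq_Ico, Finset.sum_Ico_add' (fun j => (x * ((j : ℕ) : ZMod m)).val) 0 J 1]
    push_cast
    rfl
  have h4 : (2 : ℝ) * ((∑ j ∈ Finset.range J, (x * ((j + 1 : ℕ) : ZMod m)).val : ℕ) : ℝ) ≤
      (J + 1) * m + 2 * m ^ 2 := by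
    simp only [Nat.cast_zero, mul_zero, ZMod.val_zero, add_zero] at h2
    exact_mod_cast h2
  rw [← h3] at h4
  set S := ∑ j ∈ Finset.Icc 1 J, ((x * (j : ZMod m)).val : ℝ)
  have h5 : S / m ≤ (J + 1) / 2 + m := by
    rw [div_le_iff₀ (by linarith)]
    linarith
  rw [negAvgSaw, neg_le_neg_iff, inv_mul_le_iff₀ hJR, mul_add]
  have : (J : ℝ) * (2 * m / J) = 2 * m := by field_simp
  linarith

lemma negAvgSaw_inv_ge_of_dvd {m K J : ℕ} (hm : 0 < m) (hmq : m < q) (hK : 0 < K) (hJ : 0 < J)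
    (hKJ : K * J < q) (hmK : m ∣ K) : 1 / 2 - (K * J / q : ℝ) ≤ negAvgSaw K J (m : ZMod q)⁻¹ := by
  have hJR : (0 : ℝ) < J := by exact_mod_cast hJ
  have h0 : (0 : ZMod m) = -(K : ZMod m) * (q : ZMod m)⁻¹ := by
    rw [(ZMod.natCast_eq_zero_iff K m).mpr hmK, neg_zero, zero_mul]
  have h1 := sum_sawZ_mul_inv_le hm hmq hK hKJ h0
  simp only [zero_mul, ZMod.val_zero, Nat.cast_zero, Finset.sum_const_zero, zero_div,
    add_zero] at h1
  rw [negAvgSaw, le_neg, inv_mul_le_iff₀ hJR]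
  linarith

end

lemma abs_cot_le {θ : ℝ} (h0 : 0 < θ) (hπ : θ < π) :
    |Real.cot θ| ≤ π / 2 * (1 / θ + 1 / (π - θ)) := by
  have hs : 0 < Real.sin θ := Real.sin_pos_of_pos_of_lt_pi h0 hπ
  have h1 : 0 < π - θ := by linarith
  have hp := Real.pi_pos
  have hsin : (π / 2 * (1 / θ + 1 / (π - θ)))⁻¹ ≤ Real.sin θ := by
    rcases le_total θ (π / 2) with h | h
    · refine le_trans ?_ (Real.mul_le_sin h0.le h)
      rw [inv_le_comm₀ (by positivity) (by positivity), mul_inv, inv_div, ← one_div θ]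
      have : 0 ≤ 1 / (π - θ) := by positivity
      gcongr
      linarith
    · rw [← Real.sin_pi_sub]
      refine le_trans ?_ (Real.mul_le_sin h1.le (by linarith))
      rw [inv_le_comm₀ (by positivity) (by positivity), mul_inv, inv_div, ← one_div (π - θ)]
      have : 0 ≤ 1 / θ := by positivity
      gcongr
      linarith
  rw [Real.cot_eq_cos_div_sin, abs_div, abs_of_pos hs]
  calc |Real.cos θ| / Real.sin θ ≤ 1 / Real.sin θ := by gcongr; exact Real.abs_cos_le_one θ
    _ ≤ _ := by rw [one_div]; exact inv_le_of_inv_le₀ (by positivity) hsin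

lemma norm_sawHat_le {q : ℕ} [NeZero q] (y : ZMod q) :
    ‖sawHat y‖ ≤ q / 4 * (1 / (y.val : ℝ) + 1 / ((-y).val : ℝ)) := by
  by_cases hy : y = 0
  · rw [hy, sawHat_zero, norm_zero]
    positivity
  have hq : (0 : ℝ) < q := Nat.cast_pos.mpr (NeZero.pos q)
  have hv : (0 : ℝ) < y.val :=
    Nat.cast_pos.mpr (Nat.pos_of_ne_zero (by simpa [ZMod.val_eq_zero] using hy))
  have hvq : (y.val : ℝ) < q := by exact_mod_cast ZMod.val_lt y
  have hneg : ((-y).val : ℝ) = q - y.val := by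
    rw [ZMod.neg_val, if_neg hy, Nat.cast_sub (ZMod.val_lt y).le]
  have h0 : 0 < π * (y.val / q : ℝ) := by positivity
  have h1 : π * (y.val / q : ℝ) < π := by
    have : (y.val / q : ℝ) < 1 := by rwa [div_lt_one hq]
    nlinarith [Real.pi_pos]
  have h2 := abs_cot_le h0 h1
  rw [sawHat, sum_sawZ_mul_stdAddChar hy, norm_mul]
  have h3 : (π : ℂ) * ((y.val / q : ℝ) : ℂ) = ((π * (y.val / q : ℝ) : ℝ) : ℂ) := by push_cast; rfl
  rw [h3, ← Complex.ofReal_cot, Complex.norm_real, Real.norm_eq_abs]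
  have h4 : ‖I / 2‖ = 1 / 2 := by simp
  rw [h4]
  refine (mul_le_mul_of_nonneg_left h2 (by norm_num)).trans (le_of_eq ?_)
  rw [hneg]
  have h5 : π - π * (y.val / q : ℝ) = π / q * (q - y.val) := by field_simp
  have h6 : (q : ℝ) - y.val ≠ 0 := by linarith
  have h7 := Real.pi_pos.ne'
  rw [h5]
  field_simp
  ring

lemma sum_norm_sawHat_div_le {q : ℕ} [NeZero q] :
    ∑ y : ZMod q, ‖sawHat y / q‖ ≤ (1 + Real.log q) / 2 := by
  have hq : (0 : ℝ) < q := Nat.cast_pos.mpr (NeZero.pos q)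
  have h : ∀ y : ZMod q, ‖sawHat y / q‖ ≤ 1 / 4 * (1 / (y.val : ℝ) + 1 / ((-y).val : ℝ)) := by
    intro y
    rw [norm_div, Complex.norm_natCast, div_le_iff₀ hq]
    refine (norm_sawHat_le y).trans (le_of_eq (by ring))
  refine (Finset.sum_le_sum fun y _ => h y).trans ?_
  rw [← Finset.mul_sum, Finset.sum_add_distrib]
  have h1 : ∑ y : ZMod q, 1 / ((-y).val : ℝ) = ∑ y : ZMod q, 1 / (y.val : ℝ) :=
    Fintype.sum_equiv (Equiv.neg _) _ _ fun y => by simp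
  rw [h1]
  have := sum_inv_val_le (q := q)
  linarith

section
variable {q : ℕ} [Fact q.Prime]

lemma sum_norm_sq_avg_stdAddChar {J : ℕ} (hJ : 0 < J) (hJq : J < q) {y : ZMod q} (hy : y ≠ 0) :
    ∑ b : ZMod q, ‖(J : ℂ)⁻¹ * ∑ j ∈ Finset.Icc 1 J, ZMod.stdAddChar ((j : ZMod q) * b * y)‖ ^ 2 =
      q / J := by
  have hJ' : (J : ℂ) ≠ 0 := by exact_mod_cast hJ.ne'
  have h1 (b : ZMod q) :
      ((‖(J : ℂ)⁻¹ * ∑ j ∈ Finset.Icc 1 J, ZMod.stdAddChar ((j : ZMod q) * b * y)‖ ^ 2 : ℝ) : ℂ) =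
      (J : ℂ)⁻¹ ^ 2 * ∑ i ∈ Finset.Icc 1 J, ∑ j ∈ Finset.Icc 1 J,
        ZMod.stdAddChar (b * (((i : ZMod q) - (j : ZMod q)) * y)) := by
    push_cast
    rw [← Complex.mul_conj', map_mul, map_inv₀, Complex.conj_natCast, map_sum, mul_mul_mul_comm,
      Finset.sum_mul_sum, ← sq]
    congr 1
    refine Finset.sum_congr rfl fun i _ => Finset.sum_congr rfl fun j _ => ?_
    rw [← AddChar.map_neg_eq_conj, ← AddChar.map_add_eq_mul]
    congr 1
    ring
  have h2 : ((∑ b : ZMod q, ‖(J : ℂ)⁻¹ * ∑ j ∈ Finset.Icc 1 J,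
      ZMod.stdAddChar ((j : ZMod q) * b * y)‖ ^ 2 : ℝ) : ℂ) = ((q / J : ℝ) : ℂ) := by
    rw [Complex.ofReal_sum]
    simp_rw [h1]
    rw [← Finset.mul_sum, Finset.sum_comm]
    have h3 : ∀ i ∈ Finset.Icc 1 J, ∑ b : ZMod q, ∑ j ∈ Finset.Icc 1 J,
        (ZMod.stdAddChar (b * (((i : ZMod q) - (j : ZMod q)) * y)) : ℂ) = q := by
      intro i hi
      rw [Finset.sum_comm, Finset.sum_eq_single i]
      · rw [sum_stdAddChar_mul, sub_self, zero_mul, if_pos rfl]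
      · intro j hj hji
        rw [sum_stdAddChar_mul, if_neg]
        refine mul_ne_zero (sub_ne_zero.mpr fun h => hji ?_) hy
        rw [Finset.mem_Icc] at hi hj
        rw [ZMod.natCast_eq_natCast_iff', Nat.mod_eq_of_lt (by omega),
          Nat.mod_eq_of_lt (by omega)] at h
        exact h.symm
      · exact fun h => absurd hi h
    rw [Finset.sum_congr rfl h3]
    simp only [Finset.sum_const, Nat.card_Icc, add_tsub_cancel_right, nsmul_eq_mul]
    push_cast
    field_simp
  exact_mod_cast h2

lemma sum_negAvgSaw_sq_le {K J : ℕ} (hK : (K : ZMod q) ≠ 0) (hJ : 0 < J) (hJq : J < q) :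
    ∑ b : ZMod q, negAvgSaw K J b ^ 2 ≤ ((1 + Real.log q) / 2) ^ 2 * (q / J) := by
  have hq : (q : ℂ) ≠ 0 := Nat.cast_ne_zero.mpr (NeZero.ne q)
  set E : ZMod q → ZMod q → ℂ := fun y b =>
    (J : ℂ)⁻¹ * ∑ j ∈ Finset.Icc 1 J, ZMod.stdAddChar ((j : ZMod q) * b * y) with hE
  set c : ZMod q → ℂ := fun y => sawHat y / q with hc
  have h1 : ∑ b : ZMod q, negAvgSaw K J b ^ 2 = ∑ b : ZMod q, negAvgSaw 1 J b ^ 2 := by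
    refine Fintype.sum_equiv (Equiv.mulLeft₀ (K : ZMod q) hK) _ _ fun b => ?_
    have (j : ℕ) : ((K * j : ℕ) : ZMod q) * b = ((1 * j : ℕ) : ZMod q) * ((K : ZMod q) * b) := by
      push_cast
      ring
    simp only [negAvgSaw, this]
    rfl
  have h2 (b : ZMod q) : ((negAvgSaw 1 J b : ℝ) : ℂ) = -∑ y, c y * E y b := by
    have h3 (x : ZMod q) : (sawZ x : ℂ) = ∑ y, c y * ZMod.stdAddChar (x * y) := by
      have : ∀ y, c y * ZMod.stdAddChar (x * y) = (q : ℂ)⁻¹ *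
          (sawHat y * ZMod.stdAddChar (x * y)) := fun y => by rw [hc]; ring
      simp_rw [this]
      rw [← Finset.mul_sum, sum_sawHat_mul_stdAddChar]
      field_simp
    rw [negAvgSaw]
    push_cast
    simp_rw [h3, one_mul]
    congr 1
    rw [Finset.sum_comm, Finset.mul_sum]
    refine Finset.sum_congr rfl fun y _ => ?_
    rw [hE, ← Finset.mul_sum]
    ring
  have h3 (b : ZMod q) : negAvgSaw 1 J b ^ 2 ≤ (∑ y, ‖c y‖) * ∑ y, ‖c y‖ * ‖E y b‖ ^ 2 := by
    have h4 : |negAvgSaw 1 J b| ≤ ∑ y, ‖c y‖ * ‖E y b‖ := by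
      rw [← Real.norm_eq_abs, ← Complex.norm_real, h2, norm_neg]
      refine (norm_sum_le _ _).trans (le_of_eq ?_)
      simp only [norm_mul]
    rw [← sq_abs]
    refine (pow_le_pow_left₀ (abs_nonneg _) h4 2).trans ?_
    exact Finset.sum_sq_le_sum_mul_sum_of_sq_le_mul _ (fun y _ => norm_nonneg _)
      (fun y _ => by positivity) fun y _ => (by ring : _ = _).le
  have hlog : 0 ≤ Real.log q := Real.log_natCast_nonneg q
  have hs := sum_norm_sawHat_div_le (q := q)
  have hs0 : 0 ≤ ∑ y, ‖c y‖ := Finset.sum_nonneg fun y _ => norm_nonneg _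
  rw [h1]
  calc ∑ b : ZMod q, negAvgSaw 1 J b ^ 2
      ≤ ∑ b : ZMod q, (∑ y, ‖c y‖) * ∑ y, ‖c y‖ * ‖E y b‖ ^ 2 := Finset.sum_le_sum fun b _ => h3 b
    _ = (∑ y, ‖c y‖) * ∑ y, ‖c y‖ * ∑ b, ‖E y b‖ ^ 2 := by
        rw [← Finset.mul_sum, Finset.sum_comm]
        simp_rw [Finset.mul_sum]
    _ = (∑ y, ‖c y‖) * ∑ y, ‖c y‖ * (q / J) := by
        congr 1
        refine Finset.sum_congr rfl fun y _ => ?_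
        by_cases hy : y = 0
        · simp [hc, hy, sawHat_zero]
        · rw [hE, sum_norm_sq_avg_stdAddChar hJ hJq hy]
    _ = (∑ y, ‖c y‖) ^ 2 * (q / J) := by rw [← Finset.sum_mul]; ring
    _ ≤ _ := by gcongr
end

lemma sum_filter_range_mul {f : ℕ → ℝ} {n M q : ℕ} (hn : 0 < n) (hM : M < q) :
    ∑ i ∈ Finset.range q with i * n ≤ M, f (i * n) =
      ∑ m ∈ Finset.range (M + 1) with n ∣ m, f m := by
  refine Finset.sum_nbij' (fun i => i * n) (fun m => m / n) ?_ ?_ ?_ ?_ ?_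
  · intro i hi
    simp only [Finset.mem_filter, Finset.mem_range] at hi ⊢
    exact ⟨by omega, Dvd.intro_left i rfl⟩
  · intro m hm
    simp only [Finset.mem_filter, Finset.mem_range] at hm ⊢
    have := Nat.div_le_self m n
    rw [Nat.div_mul_cancel hm.2]
    omega
  · intro i _
    exact Nat.mul_div_cancel i hn
  · intro m hm
    exact Nat.div_mul_cancel (Finset.mem_filter.mp hm).2
  · intro i _
    rfl

lemma sum_powerset_neg_one_pow_of_dvd {P : Finset ℕ} (hP : ∀ p ∈ P, p.Prime) (m : ℕ) :
    ∑ T ∈ P.powerset with (∏ p ∈ T, p) ∣ m, (-1 : ℝ) ^ T.card =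
      if ∀ p ∈ P, ¬ p ∣ m then 1 else 0 := by
  have h1 : P.powerset.filter (fun T => (∏ p ∈ T, p) ∣ m) =
      (P.filter (fun p => p ∣ m)).powerset := by
    ext T
    simp only [Finset.mem_filter, Finset.mem_powerset, Finset.subset_iff]
    constructor
    · rintro ⟨h1, h2⟩ p hp
      exact ⟨h1 hp, (Finset.dvd_prod_of_mem _ hp).trans h2⟩
    · intro h
      exact ⟨fun p hp => (h hp).1, Finset.prod_primes_dvd m
        (fun p hp => (hP p (h hp).1).prime) fun p hp => (h hp).2⟩
  have h2 := Finset.sum_powerset_neg_one_pow_card (x := P.filter (fun p => p ∣ m))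
  have h3 : ((∑ T ∈ (P.filter (fun p => p ∣ m)).powerset, (-1 : ℤ) ^ T.card : ℤ) : ℝ) =
      ((if P.filter (fun p => p ∣ m) = ∅ then 1 else 0 : ℤ) : ℝ) := by rw [h2]
  push_cast at h3
  rw [h1, h3]
  simp only [Finset.filter_eq_empty_iff]

section
variable {q : ℕ} [Fact q.Prime]

/-- The part of `lam` left over after removing `1 / a` for `a ≤ M / n`. -/
noncomputable def lamTail (M n : ℕ) (a : ZMod q) : ℝ :=
  if a = 0 then 0 else lam a - if a.val * n ≤ M then 1 / (a.val : ℝ) else 0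

lemma lamTail_sq_le {M n K : ℕ} (hM : 0 < M) (hnK : n ≤ K) (a : ZMod q) :
    lamTail M n a ^ 2 ≤ 1 / (q : ℝ) ^ 2 + 4 * K / M * (1 / (a.val : ℝ)) := by
  have hq : (0 : ℝ) < q := Nat.cast_pos.mpr (NeZero.pos q)
  have hMR : (0 : ℝ) < M := by exact_mod_cast hM
  rw [lamTail]
  split_ifs with ha hv
  · rw [zero_pow two_ne_zero]
    positivity
  · have h1 := inv_val_le_lam ha
    have h2 := lam_le_inv_val ha
    have h3 : (lam a - 1 / (a.val : ℝ)) ^ 2 ≤ (1 / (q : ℝ)) ^ 2 :=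
      pow_le_pow_left₀ (by linarith) (by linarith) 2
    rw [div_pow, one_pow] at h3
    have : 0 ≤ 4 * K / M * (1 / (a.val : ℝ)) := by positivity
    linarith
  · have h1 := inv_val_le_lam ha
    have h2 := lam_le_inv_val ha
    have hv0 : (0 : ℝ) < a.val :=
      Nat.cast_pos.mpr (Nat.pos_of_ne_zero (by simpa [ZMod.val_eq_zero] using ha))
    have hvq : 1 / (q : ℝ) ≤ 1 / a.val :=
      one_div_le_one_div_of_le hv0 (by exact_mod_cast (ZMod.val_lt a).le)
    have h3 : (lam a - 0) ^ 2 ≤ (2 * (1 / (a.val : ℝ))) ^ 2 := by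
      refine pow_le_pow_left₀ ?_ (by linarith) 2
      have : 0 ≤ 1 / (a.val : ℝ) := by positivity
      linarith
    refine h3.trans ?_
    have h4 : 1 / (a.val : ℝ) ≤ K / M := by
      rw [div_le_div_iff₀ hv0 hMR, one_mul]
      have : (M : ℝ) ≤ n * a.val := by
        push Not at hv
        rw [mul_comm] at hv
        exact_mod_cast hv.le
      have h5 : (n : ℝ) * a.val ≤ K * a.val := by
        have : (n : ℝ) ≤ K := by exact_mod_cast hnK
        gcongr
      linarith
    have h6 : 0 ≤ 1 / (q : ℝ) ^ 2 := by positivity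
    have h7 : (0 : ℝ) < 1 / a.val := by positivity
    calc (2 * (1 / (a.val : ℝ))) ^ 2 = 4 * (1 / (a.val : ℝ)) * (1 / a.val) := by ring
      _ ≤ 4 * (K / M) * (1 / a.val) := by gcongr
      _ = 4 * K / M * (1 / a.val) := by ring
      _ ≤ _ := by linarith

lemma sum_lamTail_sq_le {M n K : ℕ} (hM : 0 < M) (hnK : n ≤ K) :
    ∑ a : ZMod q, lamTail M n a ^ 2 ≤ 1 / (q : ℝ) + 4 * K / M * (1 + Real.log q) := by
  have hq : (0 : ℝ) < q := Nat.cast_pos.mpr (NeZero.pos q)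
  refine (Finset.sum_le_sum fun a _ => lamTail_sq_le hM hnK a).trans ?_
  rw [Finset.sum_add_distrib, ← Finset.mul_sum]
  have h2 : ∑ _a : ZMod q, 1 / (q : ℝ) ^ 2 = 1 / (q : ℝ) := by
    rw [Finset.sum_const, Finset.card_univ, ZMod.card, nsmul_eq_mul]
    field_simp
  rw [h2]
  have := sum_inv_val_le (q := q)
  gcongr

lemma negAvgSaw_zero (K J : ℕ) : negAvgSaw K J (0 : ZMod q) = 0 := by
  simp [negAvgSaw, sawZ_zero]

lemma sum_lam_mul_negAvgSaw (K J : ℕ) {M n : ℕ} (c : ZMod q) (hM : M < q)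
    (hn : (n : ZMod q) ≠ 0) :
    ∑ a, lam a * negAvgSaw K J (c * a⁻¹) =
      n * ∑ m ∈ Finset.range (M + 1) with n ∣ m,
        1 / (m : ℝ) * negAvgSaw K J (c * (n : ZMod q) * (m : ZMod q)⁻¹) +
      ∑ a, lamTail M n a * negAvgSaw K J (c * a⁻¹) := by
  have hn0 : 0 < n := Nat.pos_of_ne_zero fun h => hn (by rw [h, Nat.cast_zero])
  have h1 (a : ZMod q) : lam a * negAvgSaw K J (c * a⁻¹) =
      (if a.val * n ≤ M then 1 / (a.val : ℝ) * negAvgSaw K J (c * a⁻¹) else 0) +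
        lamTail M n a * negAvgSaw K J (c * a⁻¹) := by
    by_cases ha : a = 0
    · simp [ha, negAvgSaw_zero]
    · rw [lamTail, if_neg ha]
      split_ifs <;> ring
  simp_rw [h1]
  rw [Finset.sum_add_distrib]
  congr 1
  rw [← sum_filter_range_mul hn0 hM
    (f := fun m => 1 / (m : ℝ) * negAvgSaw K J (c * (n : ZMod q) * (m : ZMod q)⁻¹)),
    Finset.mul_sum, Finset.sum_filter, sum_zmod_eq_sum_range]
  refine Finset.sum_congr rfl fun i hi => ?_
  rw [ZMod.val_cast_of_lt (by simpa using hi)]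
  split_ifs
  · have h2 : c * (n : ZMod q) * ((i * n : ℕ) : ZMod q)⁻¹ = c * (i : ZMod q)⁻¹ := by
      push_cast
      rw [mul_inv]
      field_simp
    have hnR : (n : ℝ) ≠ 0 := by exact_mod_cast hn0.ne'
    rw [h2, ← mul_assoc]
    congr 1
    push_cast
    rw [one_div, one_div, mul_inv, mul_comm (i : ℝ)⁻¹, mul_inv_cancel_left₀ hnR]
  · rfl

lemma abs_sum_lamTail_mul_le {K J M n : ℕ} (hM : 0 < M) (hnK : n ≤ K) (hK : (K : ZMod q) ≠ 0)
    (hJ : 0 < J) (hJq : J < q) {c : ZMod q} (hc : c ≠ 0) :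
    |∑ a, lamTail M n a * negAvgSaw K J (c * a⁻¹)| ≤
      √((1 / (q : ℝ) + 4 * K / M * (1 + Real.log q)) *
        (((1 + Real.log q) / 2) ^ 2 * (q / J))) := by
  apply Real.abs_le_sqrt
  refine (Finset.sum_mul_sq_le_sq_mul_sq _ _ _).trans ?_
  have h1 : ∑ a : ZMod q, negAvgSaw K J (c * a⁻¹) ^ 2 = ∑ b : ZMod q, negAvgSaw K J b ^ 2 :=
    Fintype.sum_equiv ((Equiv.inv (ZMod q)).trans (Equiv.mulLeft₀ c hc)) _ _ fun a => rfl
  rw [h1]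
  have hlog : 0 ≤ Real.log q := Real.log_natCast_nonneg q
  exact mul_le_mul (sum_lamTail_sq_le hM hnK) (sum_negAvgSaw_sq_le hK hJ hJq)
    (Finset.sum_nonneg fun _ _ => sq_nonneg _) (by positivity)

lemma sum_negAvgSaw_coprime_ge {P : Finset ℕ} {K J M e : ℕ} (hK : 0 < K) (hJ : 0 < J) (hM : 0 < M)
    (hP : ∀ p ∈ P, p.Prime) (hKJ : K * J < q) (hKM : K * M < q) (he : e ∣ K) :
    1 / 2 - K * J / q - (1 + Real.log M) * (K * J / q + 2 * K * M / J) ≤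
      ∑ m ∈ Finset.range (M + 1), (if ∀ p ∈ P, ¬ p ∣ m then 1 else 0) *
        (1 / (m : ℝ) * negAvgSaw K J ((e * m : ℕ) : ZMod q)⁻¹) := by
  have hJR : (0 : ℝ) < J := by exact_mod_cast hJ
  have hKR : (0 : ℝ) < K := by exact_mod_cast hK
  have hq : (0 : ℝ) < q := Nat.cast_pos.mpr (NeZero.pos q)
  have heK : e ≤ K := Nat.le_of_dvd hK he
  have he0 : 0 < e := Nat.pos_of_dvd_of_pos he hK
  set δ : ℝ := K * J / q + 2 * K * M / J with hδ
  have hδ0 : 0 ≤ δ := by positivity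
  have hmain : ∀ m ∈ Finset.range (M + 1),
      (if m = 1 then 1 / 2 - K * J / q else 0 : ℝ) - 1 / (m : ℝ) * δ ≤
      (if ∀ p ∈ P, ¬ p ∣ m then 1 else 0) *
        (1 / (m : ℝ) * negAvgSaw K J ((e * m : ℕ) : ZMod q)⁻¹) := by
    intro m hm
    have hmM : m ≤ M := by simpa [Nat.lt_succ_iff] using hm
    rcases Nat.eq_zero_or_pos m with rfl | hm0
    · simp
    by_cases h1 : m = 1
    · subst h1
      rw [if_pos rfl, if_pos fun p hp h => (hP p hp).one_lt.ne' (Nat.dvd_one.mp h), one_mul,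
        mul_one, Nat.cast_one, div_one, one_mul, one_mul]
      have := negAvgSaw_inv_ge_of_dvd he0 (by nlinarith) hK hJ hKJ he
      linarith
    · rw [if_neg h1, zero_sub]
      have hem : e * m ≤ K * M := Nat.mul_le_mul heK hmM
      have h2 := negAvgSaw_inv_ge (m := e * m) (Nat.mul_pos he0 hm0) (by omega) hK hJ hKJ
      have h3 : -δ ≤ negAvgSaw K J ((e * m : ℕ) : ZMod q)⁻¹ := by
        refine le_trans ?_ h2
        have : ((e * m : ℕ) : ℝ) ≤ K * M := by exact_mod_cast hem
        rw [neg_le_neg_iff, hδ, mul_assoc 2 (K : ℝ)]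
        gcongr
      have h4 : (0 : ℝ) ≤ 1 / (m : ℝ) := by positivity
      split_ifs
      · nlinarith
      · rw [zero_mul]
        nlinarith
  refine le_trans ?_ (Finset.sum_le_sum hmain)
  rw [Finset.sum_sub_distrib, Finset.sum_ite_eq', if_pos (by simpa using hM), ← Finset.sum_mul]
  have h5 : ∑ m ∈ Finset.range (M + 1), 1 / (m : ℝ) ≤ 1 + Real.log M := by
    refine le_trans (le_of_eq ?_) (harmonic_le_one_add_log M)
    rw [Finset.sum_range_succ', harmonic]
    push_cast
    simp
  have := mul_le_mul_of_nonneg_right h5 hδ0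
  linarith

/-- The average of the main sum over multiples of the product of the primes in `P`. -/
lemma sum_powerset_ge {P : Finset ℕ} {K J M e : ℕ} (hJ : 0 < J) (hM : 0 < M)
    (hP : ∀ p ∈ P, p.Prime) (hKP : K = ∏ p ∈ P, p) (hKJ : K * J < q) (hKM : K * M < q)
    (he : e ∣ K) :
    1 / 2 - K * J / q - (1 + Real.log M) * (K * J / q + 2 * K * M / J) -
      K * √((1 / (q : ℝ) + 4 * K / M * (1 + Real.log q)) *
        (((1 + Real.log q) / 2) ^ 2 * (q / J))) ≤
      ∑ T ∈ P.powerset, (-1 : ℝ) ^ T.card / ((∏ p ∈ T, p : ℕ) : ℝ) *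
        ∑ a, lam a * negAvgSaw K J (((e * ∏ p ∈ T, p : ℕ) : ZMod q)⁻¹ * a⁻¹) := by
  have hK : 0 < K := hKP ▸ Finset.prod_pos fun p hp => (hP p hp).pos
  have hcast {a : ℕ} (ha : a ∣ K) : (a : ZMod q) ≠ 0 := by
    rw [Ne, ZMod.natCast_eq_zero_iff]
    intro h
    have h1 := Nat.le_of_dvd hK (h.trans ha)
    nlinarith
  have hdvd : ∀ T ∈ P.powerset, (∏ p ∈ T, p) ∣ K := fun T hT =>
    hKP ▸ Finset.prod_dvd_prod_of_subset _ _ _ (Finset.mem_powerset.mp hT)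
  have hMq : M < q := by nlinarith
  have hJq : J < q := by nlinarith
  set Rt := √((1 / (q : ℝ) + 4 * K / M * (1 + Real.log q)) *
        (((1 + Real.log q) / 2) ^ 2 * (q / J))) with hRt
  set f : ℕ → ℝ := fun m => 1 / (m : ℝ) * negAvgSaw K J ((e * m : ℕ) : ZMod q)⁻¹ with hf
  have hterm : ∀ T ∈ P.powerset,
      (-1 : ℝ) ^ T.card * (∑ m ∈ Finset.range (M + 1) with (∏ p ∈ T, p) ∣ m, f m) - Rt ≤
      (-1 : ℝ) ^ T.card / ((∏ p ∈ T, p : ℕ) : ℝ) *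
        ∑ a, lam a * negAvgSaw K J (((e * ∏ p ∈ T, p : ℕ) : ZMod q)⁻¹ * a⁻¹) := by
    intro T hT
    have hn := hcast (hdvd T hT)
    have hnK := Nat.le_of_dvd hK (hdvd T hT)
    have hn1 : 1 ≤ ∏ p ∈ T, p := Nat.pos_of_dvd_of_pos (hdvd T hT) hK
    set n := ∏ p ∈ T, p
    have hnR : (1 : ℝ) ≤ n := by exact_mod_cast hn1
    have hc : ((e * n : ℕ) : ZMod q)⁻¹ ≠ 0 := by
      push_cast
      exact inv_ne_zero (mul_ne_zero (hcast he) hn)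
    rw [sum_lam_mul_negAvgSaw K J _ hMq hn]
    have h1 := abs_sum_lamTail_mul_le hM hnK (hcast dvd_rfl) hJ hJq hc
    rw [← hRt] at h1
    have h2 : ∀ m : ℕ, ((e * n : ℕ) : ZMod q)⁻¹ * (n : ZMod q) * (m : ZMod q)⁻¹ =
        ((e * m : ℕ) : ZMod q)⁻¹ := by
      intro m
      push_cast
      rw [mul_inv, mul_inv, inv_mul_cancel_right₀ hn]
    simp_rw [h2]
    set E := ∑ a, lamTail M n a * negAvgSaw K J (((e * n : ℕ) : ZMod q)⁻¹ * a⁻¹)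
    have h3 : (-1 : ℝ) ^ T.card / (n : ℝ) * ((n : ℝ) *
        ∑ m ∈ Finset.range (M + 1) with n ∣ m, f m + E) =
        (-1 : ℝ) ^ T.card * (∑ m ∈ Finset.range (M + 1) with n ∣ m, f m) +
          (-1 : ℝ) ^ T.card / (n : ℝ) * E := by
      field_simp
    rw [h3]
    have h4 : |(-1 : ℝ) ^ T.card / (n : ℝ) * E| ≤ Rt := by
      rw [abs_mul, abs_div, abs_pow, abs_neg, abs_one, one_pow, abs_of_pos (by linarith)]
      have : 1 / (n : ℝ) ≤ 1 := by rw [div_le_one (by linarith)]; exact hnR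
      calc 1 / (n : ℝ) * |E| ≤ 1 * |E| := by gcongr
        _ ≤ Rt := by rw [one_mul]; exact h1
    have := (abs_le.mp h4).1
    linarith
  refine le_trans ?_ (Finset.sum_le_sum hterm)
  rw [Finset.sum_sub_distrib]
  have hcard : ((P.powerset.card : ℕ) : ℝ) ≤ K := by
    rw [Finset.card_powerset, hKP]
    exact_mod_cast Finset.pow_card_le_prod P (fun p => p) 2 fun p hp => (hP p hp).two_le
  have hR : ∑ _T ∈ P.powerset, Rt ≤ K * Rt := by
    rw [Finset.sum_const, nsmul_eq_mul]
    exact mul_le_mul_of_nonneg_right hcard (Real.sqrt_nonneg _)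
  have hmain : ∑ T ∈ P.powerset, (-1 : ℝ) ^ T.card *
      (∑ m ∈ Finset.range (M + 1) with (∏ p ∈ T, p) ∣ m, f m) =
      ∑ m ∈ Finset.range (M + 1), (if ∀ p ∈ P, ¬ p ∣ m then 1 else 0) * f m := by
    simp_rw [← sum_powerset_neg_one_pow_of_dvd hP, Finset.sum_filter, Finset.sum_mul,
      Finset.mul_sum]
    rw [Finset.sum_comm]
    refine Finset.sum_congr rfl fun m _ => Finset.sum_congr rfl fun T _ => ?_
    split_ifs <;> ring
  rw [hmain]
  have := sum_negAvgSaw_coprime_ge hK hJ hM hP hKJ hKM he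
  linarith

end

section
variable {q : ℕ} [Fact q.Prime]

/-- The coefficient of `χ (∏ p ∈ U, p)` in `∏ p ∈ P, (u p + v p * χ p)`, where
`u p = 1 - 1 / (p - 1) ^ 2` and `v p = p / (p - 1) ^ 2`. -/
noncomputable def eulerCoeff (P U : Finset ℕ) : ℝ :=
  (∏ p ∈ U, (p : ℝ) / ((p : ℝ) - 1) ^ 2) * ∏ p ∈ P \ U, (1 - 1 / ((p : ℝ) - 1) ^ 2)

lemma eulerCoeff_nonneg {P U : Finset ℕ} (hP : ∀ p ∈ P, p.Prime) : 0 ≤ eulerCoeff P U := by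
  refine mul_nonneg (Finset.prod_nonneg fun p _ => by positivity)
    (Finset.prod_nonneg fun p hp => ?_)
  have h2 : (2 : ℝ) ≤ p := by exact_mod_cast (hP p (Finset.mem_sdiff.mp hp).1).two_le
  rw [sub_nonneg, div_le_one (by nlinarith)]
  nlinarith

lemma sum_eulerCoeff {P : Finset ℕ} (hP : ∀ p ∈ P, p.Prime) :
    ∑ U ∈ P.powerset, eulerCoeff P U = ∏ p ∈ P, (1 - (p : ℝ)⁻¹)⁻¹ := by
  simp only [eulerCoeff]
  rw [← Finset.prod_add]
  refine Finset.prod_congr rfl fun p hp => ?_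
  have h2 : (2 : ℝ) ≤ p := by exact_mod_cast (hP p hp).two_le
  have h3 : (p : ℝ) - 1 ≠ 0 := by linarith
  have h4 : (p : ℝ) ≠ 0 := by linarith
  have h5 : 1 - (p : ℝ)⁻¹ = ((p : ℝ) - 1) / p := by field_simp
  rw [h5, inv_div]
  field_simp
  ring

lemma prod_AqFactor_eq {P : Finset ℕ} (hP : ∀ p ∈ P, p.Prime) (hPq : ∀ p ∈ P, ¬ p ∣ q)
    (χ : DirichletCharacter ℂ q) :
    ∏ p ∈ P, AqFactor χ p = ∑ U ∈ P.powerset, (eulerCoeff P U : ℂ) *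
      ∑ T ∈ P.powerset, (((-1 : ℝ) ^ T.card / ((∏ p ∈ T, p : ℕ) : ℝ) : ℝ) : ℂ) *
        χ (((∏ p ∈ U, p) * ∏ p ∈ T, p : ℕ) : ZMod q) := by
  have h1 : ∏ p ∈ P, AqFactor χ p =
      (∏ p ∈ P, ((p : ℂ) / ((p : ℂ) - 1) ^ 2 * χ (p : ZMod q) + (1 - 1 / ((p : ℂ) - 1) ^ 2))) *
        ∏ p ∈ P, (-(χ (p : ZMod q) / p) + 1) := by
    rw [← Finset.prod_mul_distrib]
    refine Finset.prod_congr rfl fun p hp => ?_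
    have h2 : (p : ℂ) ≠ 0 := by exact_mod_cast (hP p hp).ne_zero
    have h3 : (p : ℂ) - 1 ≠ 0 := by
      rw [sub_ne_zero]; exact_mod_cast (hP p hp).one_lt.ne'
    rw [AqFactor, if_neg (hPq p hp)]
    field_simp
    ring
  rw [h1, Finset.prod_add, Finset.prod_add, Finset.sum_mul]
  refine Finset.sum_congr rfl fun U _ => ?_
  rw [Finset.mul_sum, Finset.mul_sum]
  refine Finset.sum_congr rfl fun T _ => ?_
  simp only [eulerCoeff, Finset.prod_const_one, mul_one, Finset.prod_mul_distrib]
  have h4 : ∏ p ∈ T, -(χ (p : ZMod q) / (p : ℂ)) =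
      (-1) ^ T.card / (∏ p ∈ T, (p : ℂ)) * ∏ p ∈ T, χ (p : ZMod q) := by
    rw [Finset.prod_neg, Finset.prod_div_distrib]
    ring
  rw [h4]
  push_cast
  rw [map_mul, map_prod, map_prod]
  ring

lemma neg_re_charHat_prod_eq {P : Finset ℕ} (hP : ∀ p ∈ P, p.Prime) (hPq : ∀ p ∈ P, ¬ p ∣ q)
    {k : ZMod q} (hk : k ≠ 0) :
    -(charHat (fun χ => (∏ p ∈ P, AqFactor χ p) * negLL χ) k).re =
      ∑ U ∈ P.powerset, eulerCoeff P U *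
        ∑ T ∈ P.powerset, (-1 : ℝ) ^ T.card / ((∏ p ∈ T, p : ℕ) : ℝ) *
          dedSum (k * (((∏ p ∈ U, p) * ∏ p ∈ T, p : ℕ) : ZMod q)⁻¹) := by
  have hne : ∀ T ⊆ P, ((∏ p ∈ T, p : ℕ) : ZMod q) ≠ 0 := fun T hT => by
    rw [Nat.cast_prod, Finset.prod_ne_zero_iff]
    intro p hp h
    rw [ZMod.natCast_eq_zero_iff] at h
    have := (Nat.prime_dvd_prime_iff_eq Fact.out (hP p (hT hp))).mp h
    exact hPq p (hT hp) (by rw [this])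
  have h1 : charHat (fun χ => (∏ p ∈ P, AqFactor χ p) * negLL χ) k =
      -((∑ U ∈ P.powerset, eulerCoeff P U *
        ∑ T ∈ P.powerset, (-1 : ℝ) ^ T.card / ((∏ p ∈ T, p : ℕ) : ℝ) *
          dedSum (k * (((∏ p ∈ U, p) * ∏ p ∈ T, p : ℕ) : ZMod q)⁻¹) : ℝ) : ℂ) := by
    have h2 : (fun χ : DirichletCharacter ℂ q => (∏ p ∈ P, AqFactor χ p) * negLL χ) =
        fun χ => ∑ U ∈ P.powerset, (eulerCoeff P U : ℂ) *
          ∑ T ∈ P.powerset, (((-1 : ℝ) ^ T.card / ((∏ p ∈ T, p : ℕ) : ℝ) : ℝ) : ℂ) *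
            (χ (((∏ p ∈ U, p) * ∏ p ∈ T, p : ℕ) : ZMod q) * negLL χ) := by
      funext χ
      rw [prod_AqFactor_eq hP hPq]
      simp only [Finset.sum_mul, mul_assoc]
    rw [h2, charHat_sum, Complex.ofReal_sum, ← Finset.sum_neg_distrib]
    refine Finset.sum_congr rfl fun U hU => ?_
    rw [charHat_const_mul, charHat_sum, Complex.ofReal_mul, Complex.ofReal_sum, ← mul_neg,
      ← Finset.sum_neg_distrib]
    congr 1
    refine Finset.sum_congr rfl fun T hT => ?_
    rw [charHat_const_mul, charHat_char_mul, charHat_negLL, Complex.ofReal_mul, mul_neg]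
    refine mul_ne_zero hk (inv_ne_zero ?_)
    rw [Nat.cast_mul]
    exact mul_ne_zero (hne U (Finset.mem_powerset.mp hU)) (hne T (Finset.mem_powerset.mp hT))
  rw [h1, Complex.neg_re, neg_neg, Complex.ofReal_re]

lemma sum_Icc_dedSum (K : ℕ) {J : ℕ} (hJ : 0 < J) (b : ZMod q) :
    ∑ j ∈ Finset.Icc 1 J, dedSum (((K * j : ℕ) : ZMod q) * b) =
      J * ∑ a, lam a * negAvgSaw K J (b * a⁻¹) := by
  have hJ0 : (J : ℝ) ≠ 0 := by positivity
  simp only [dedSum, negAvgSaw, Finset.sum_neg_distrib, mul_neg, mul_assoc]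
  rw [Finset.sum_comm, neg_inj, Finset.mul_sum]
  refine Finset.sum_congr rfl fun a _ => ?_
  rw [← Finset.mul_sum, mul_left_comm, mul_inv_cancel_left₀ hJ0]

/-- Some multiple `K * j` with `1 ≤ j ≤ J` is at least as good as the average over `j`. -/
lemma exists_neg_re_charHat_prod_ge {P : Finset ℕ} {K J : ℕ} {δ : ℝ} (hJ : 0 < J)
    (hP : ∀ p ∈ P, p.Prime) (hPq : ∀ p ∈ P, ¬ p ∣ q) (hKP : K = ∏ p ∈ P, p) (hKJ : K * J < q)
    (hδ : ∀ e, e ∣ K → δ ≤ ∑ T ∈ P.powerset, (-1 : ℝ) ^ T.card / ((∏ p ∈ T, p : ℕ) : ℝ) *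
      ∑ a, lam a * negAvgSaw K J (((e * ∏ p ∈ T, p : ℕ) : ZMod q)⁻¹ * a⁻¹)) :
    ∃ j ∈ Finset.Icc 1 J, (∏ p ∈ P, (1 - (p : ℝ)⁻¹)⁻¹) * δ ≤
      -(charHat (fun χ => (∏ p ∈ P, AqFactor χ p) * negLL χ) ((K * j : ℕ) : ZMod q)).re := by
  refine Finset.exists_le_of_sum_le (Finset.nonempty_Icc.mpr hJ) ?_
  have hK : 0 < K := hKP ▸ Finset.prod_pos fun p hp => (hP p hp).pos
  have h1 : ∀ j ∈ Finset.Icc 1 J, ((K * j : ℕ) : ZMod q) ≠ 0 := fun j hj => by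
    rw [Finset.mem_Icc] at hj
    rw [Ne, ZMod.natCast_eq_zero_iff]
    exact Nat.not_dvd_of_pos_of_lt (Nat.mul_pos hK hj.1)
      ((Nat.mul_le_mul_left K hj.2).trans_lt hKJ)
  rw [Finset.sum_congr rfl fun j hj => neg_re_charHat_prod_eq hP hPq (h1 j hj), Finset.sum_comm,
    Finset.sum_const, Nat.card_Icc, nsmul_eq_mul, Nat.add_sub_cancel, ← sum_eulerCoeff hP,
    Finset.sum_mul, Finset.mul_sum]
  refine Finset.sum_le_sum fun U hU => ?_
  rw [← Finset.mul_sum, Finset.sum_comm]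
  simp only [← Finset.mul_sum, sum_Icc_dedSum K hJ]
  have h2 := hδ (∏ p ∈ U, p)
    (hKP ▸ Finset.prod_dvd_prod_of_subset _ _ _ (Finset.mem_powerset.mp hU))
  simp only [mul_left_comm _ (J : ℝ), ← Finset.mul_sum]
  exact mul_le_mul_of_nonneg_left (mul_le_mul_of_nonneg_left h2 (eulerCoeff_nonneg hP))
    (Nat.cast_nonneg J)

end

lemma log_le_prod_primesBelow {y : ℕ} (hy : 1 ≤ y) :
    Real.log y ≤ ∏ p ∈ y.primesBelow, (1 - (p : ℝ)⁻¹)⁻¹ := by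
  let f : ℕ →* ℝ :=
    { toFun := fun n => (n : ℝ)⁻¹, map_one' := by simp, map_mul' := fun a b => by simp [mul_comm] }
  have h := EulerProduct.summable_and_hasSum_smoothNumbers_prod_primesBelow_geometric (f := f)
    (fun {p} hp => by
      have : (1 : ℝ) < p := by exact_mod_cast hp.one_lt
      change ‖(p : ℝ)⁻¹‖ < 1
      rw [norm_inv, Real.norm_natCast]
      exact inv_lt_one_of_one_lt₀ this) y
  have h1 := log_add_one_le_harmonic (y - 1)
  rw [Nat.sub_add_cancel hy, harmonic_eq_sum_Icc] at h1
  push_cast at h1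
  refine h1.trans ?_
  have hmem : ∀ n ∈ Finset.Icc 1 (y - 1), n ∈ y.smoothNumbers := fun n hn => by
    rw [Finset.mem_Icc] at hn
    exact Nat.mem_smoothNumbers_of_lt hn.1 (by omega)
  have h2 := sum_le_hasSum
    (Finset.attach (Finset.Icc 1 (y - 1)) |>.map
      ⟨fun n => (⟨n.1, hmem n.1 n.2⟩ : y.smoothNumbers), fun _ _ hab =>
        by
          have h := Subtype.ext_iff.mp hab
          exact Subtype.ext h⟩)
    (fun i _ => inv_nonneg.mpr (Nat.cast_nonneg _)) h.2
  rw [Finset.sum_map] at h2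
  change ∑ n ∈ (Finset.Icc 1 (y - 1)).attach, ((n : ℕ) : ℝ)⁻¹ ≤ _ at h2
  rwa [Finset.sum_attach (Finset.Icc 1 (y - 1)) (fun n : ℕ => (n : ℝ)⁻¹)] at h2

lemma prod_primesBelow_le_four_pow (y : ℕ) : ∏ p ∈ y.primesBelow, p ≤ 4 ^ y := by
  refine le_trans ?_ (primorial_le_four_pow y)
  refine Finset.prod_le_prod_of_subset_of_one_le' ?_ fun p hp _ => ?_
  · exact Finset.filter_subset_filter _ (Finset.range_mono (Nat.le_succ y))
  · exact (Finset.mem_filter.mp hp).2.one_le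

lemma error_terms_le {r q K J M : ℝ} (hr : 1000000 ≤ r) (hq : q = r ^ 64) (hK1 : 1 ≤ K)
    (hK : K ≤ r) (hJ : r ^ 56 / 2 ≤ J) (hJ' : J ≤ r ^ 56) (hM : r ^ 32 / 2 ≤ M)
    (hM' : M ≤ r ^ 32) :
    0.49 ≤ 1 / 2 - K * J / q - (1 + Real.log M) * (K * J / q + 2 * K * M / J) -
      K * √((1 / q + 4 * K / M * (1 + Real.log q)) * (((1 + Real.log q) / 2) ^ 2 * (q / J))) := by
  have hr0 : 0 < r := by linarith
  have hr1 : 1 ≤ r := by linarith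
  have hlq : Real.log q ≤ 64 * r := by
    rw [hq, Real.log_pow]
    have := Real.log_le_self hr0.le
    push_cast; linarith
  have hM0 : 0 < M := lt_of_lt_of_le (by positivity) hM
  have hJ0 : 0 < J := lt_of_lt_of_le (by positivity) hJ
  have hq0 : 0 < q := by rw [hq]; positivity
  have hq1 : 1 ≤ q := by rw [hq]; exact one_le_pow₀ hr1
  have hlq0 : 0 ≤ Real.log q := Real.log_nonneg hq1
  have hlM : 1 + Real.log M ≤ 65 * r := by
    have : Real.log M ≤ Real.log q := by
      apply Real.log_le_log hM0
      rw [hq]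
      exact hM'.trans (pow_le_pow_right₀ hr1 (by norm_num))
    linarith
  have hM1 : 1 ≤ M := by
    have : r ≤ r ^ 32 := le_self_pow₀ hr1 (by norm_num)
    linarith
  have hlM0 : 0 ≤ Real.log M := Real.log_nonneg hM1
  have hL : 1 + Real.log q ≤ 65 * r := by linarith
  set s := r⁻¹ with hs
  have hs0 : 0 < s := inv_pos.mpr hr0
  have hs1 : s ≤ 1 / 1000000 := by
    rw [hs, inv_eq_one_div]; exact one_div_le_one_div_of_le (by norm_num) hr
  have hrs : r * s = 1 := mul_inv_cancel₀ hr0.ne'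
  have hrs' : ∀ n : ℕ, r ^ n * s ^ n = 1 := fun n => by rw [← mul_pow, hrs, one_pow]
  have h1 : K * J / q ≤ s ^ 7 := by
    rw [div_le_iff₀ hq0, hq]
    calc K * J ≤ r * r ^ 56 := by gcongr
      _ = r ^ 57 * (r ^ 7 * s ^ 7) := by rw [hrs']; ring
      _ = _ := by ring
  have h2 : 2 * K * M / J ≤ 4 * s ^ 23 := by
    rw [div_le_iff₀ hJ0]
    calc 2 * K * M ≤ 2 * r * r ^ 32 := by gcongr
      _ = 2 * r ^ 33 * (r ^ 23 * s ^ 23) := by rw [hrs']; ring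
      _ = 4 * s ^ 23 * (r ^ 56 / 2) := by ring
      _ ≤ _ := by gcongr
  have hpow : ∀ m n : ℕ, m ≤ n → s ^ n ≤ s ^ m := fun m n h =>
    pow_le_pow_of_le_one hs0.le (by linarith) h
  have h3 : (1 + Real.log M) * (K * J / q + 2 * K * M / J) ≤ 325 * s := by
    calc (1 + Real.log M) * (K * J / q + 2 * K * M / J)
        ≤ 65 * r * (s ^ 7 + 4 * s ^ 23) := by gcongr
      _ ≤ 65 * r * (s ^ 2 + 4 * s ^ 2) := by
          have := hpow 2 7 (by norm_num)
          have := hpow 2 23 (by norm_num)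
          gcongr
      _ = 325 * s * (r * s) := by ring
      _ = _ := by rw [hrs, mul_one]
  have h4 : (1 / q + 4 * K / M * (1 + Real.log q)) ≤ 521 * s ^ 30 := by
    have h5 : 1 / q ≤ s ^ 30 := by
      rw [div_le_iff₀ hq0, hq]
      calc 1 = r ^ 30 * s ^ 30 := (hrs' 30).symm
        _ ≤ r ^ 64 * s ^ 30 := by gcongr ?_ * _; exact pow_le_pow_right₀ hr1 (by norm_num)
        _ = _ := by ring
    have h6 : 4 * K / M ≤ 8 * s ^ 31 := by
      rw [div_le_iff₀ hM0]
      calc 4 * K ≤ 4 * r := by gcongr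
        _ = 4 * r * (r ^ 31 * s ^ 31) := by rw [hrs']; ring
        _ = 8 * s ^ 31 * (r ^ 32 / 2) := by ring
        _ ≤ _ := by gcongr
    calc 1 / q + 4 * K / M * (1 + Real.log q) ≤ s ^ 30 + 8 * s ^ 31 * (65 * r) := by gcongr
      _ = s ^ 30 + 520 * s ^ 30 * (r * s) := by ring
      _ = _ := by rw [hrs]; ring
  have h5 : q / J ≤ 2 * r ^ 8 := by
    rw [div_le_iff₀ hJ0, hq]
    calc r ^ 64 = 2 * r ^ 8 * (r ^ 56 / 2) := by ring
      _ ≤ _ := by gcongr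
  have h6 : (1 / q + 4 * K / M * (1 + Real.log q)) * (((1 + Real.log q) / 2) ^ 2 * (q / J)) ≤
      (1100 * s ^ 2) ^ 2 := by
    calc (1 / q + 4 * K / M * (1 + Real.log q)) * (((1 + Real.log q) / 2) ^ 2 * (q / J))
        ≤ 521 * s ^ 30 * ((65 * r / 2) ^ 2 * (2 * r ^ 8)) := by gcongr
      _ = 521 * (65 / 2) ^ 2 * 2 * s ^ 20 * (r ^ 10 * s ^ 10) := by ring
      _ = 521 * (65 / 2) ^ 2 * 2 * s ^ 20 := by rw [hrs', mul_one]
      _ ≤ 521 * (65 / 2) ^ 2 * 2 * s ^ 4 := by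
          have := hpow 4 20 (by norm_num)
          gcongr
      _ ≤ 1100 ^ 2 * s ^ 4 := by gcongr; norm_num
      _ = _ := by ring
  have h7 : K * √((1 / q + 4 * K / M * (1 + Real.log q)) *
      (((1 + Real.log q) / 2) ^ 2 * (q / J))) ≤ 1100 * s := by
    have h8 := Real.sqrt_le_sqrt h6
    rw [Real.sqrt_sq (by positivity)] at h8
    calc K * √((1 / q + 4 * K / M * (1 + Real.log q)) *
          (((1 + Real.log q) / 2) ^ 2 * (q / J))) ≤ r * (1100 * s ^ 2) := by gcongr
      _ = 1100 * s * (r * s) := by ring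
      _ = _ := by rw [hrs, mul_one]
  have h8 : s ^ 7 ≤ s := by simpa using hpow 1 7 (by norm_num)
  linarith

lemma exp_eulerMascheroniConstant_le : Real.exp Real.eulerMascheroniConstant ≤ 1.948 := by
  have h1 : Real.exp Real.eulerMascheroniConstant ≤ Real.exp (2 / 3) :=
    Real.exp_le_exp.mpr Real.eulerMascheroniConstant_lt_two_thirds.le
  refine h1.trans (le_of_pow_le_pow_left₀ (n := 3) (by norm_num) (by norm_num) ?_)
  rw [← Real.exp_nat_mul]
  have h2 : ((3 : ℕ) : ℝ) * (2 / 3) = 1 + 1 := by norm_num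
  rw [h2, Real.exp_add]
  have := Real.exp_one_lt_d9
  have := Real.exp_pos 1
  nlinarith

lemma floor_bounds {x : ℝ} (hx : 2 ≤ x) : x / 2 ≤ (⌊x⌋₊ : ℝ) ∧ (⌊x⌋₊ : ℝ) ≤ x := by
  refine ⟨?_, Nat.floor_le (by linarith)⟩
  have := Nat.lt_floor_add_one x
  linarith

lemma exists_Cfun_ge {q : ℕ} [Fact q.Prime] (hq : 1000000 ≤ Real.log q) :
    ∃ k : ℤ, 1 ≤ k ∧ k ≤ (q : ℤ) - 1 ∧
      0.49 * (Real.log (Real.log q) - Real.log 256) - 4096 * Real.exp 8 ≤ Cfun q k := by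
  have hq0 : (0 : ℝ) < q := by exact_mod_cast (Fact.out : q.Prime).pos
  set L := Real.log q with hLdef
  set r := Real.exp (L / 64) with hrdef
  have hrq : (q : ℝ) = r ^ 64 := by
    rw [hrdef, ← Real.exp_nat_mul]
    push_cast
    rw [mul_div_cancel₀ _ (by norm_num), hLdef, Real.exp_log hq0]
  have hr : 1000000 ≤ r := by
    have h1 : L / 64 / 2 + 1 ≤ Real.exp (L / 64 / 2) := Real.add_one_le_exp _
    have h2 : r = Real.exp (L / 64 / 2) ^ 2 := by
      rw [← Real.exp_nat_mul, hrdef]; congr 1; push_cast; ring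
    rw [h2]
    nlinarith
  have hr1 : 1 ≤ r := by linarith
  have hr0 : 0 < r := by linarith
  set y := ⌊L / 128⌋₊ with hydef
  have hy1 : (y : ℝ) ≤ L / 128 := Nat.floor_le (by linarith)
  have hy2 : L / 256 + 1 ≤ y := by
    have := Nat.lt_floor_add_one (L / 128)
    rw [← hydef] at this
    linarith
  have hy3 : 2 ≤ y := by
    have : (2 : ℝ) ≤ y := by linarith
    exact_mod_cast this
  have hyq : y ≤ q := by
    have h1 : L ≤ q := Real.log_le_self hq0.le
    have : (y : ℝ) ≤ q := by linarith
    exact_mod_cast this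
  have hP : ∀ p ∈ y.primesBelow, p.Prime := fun p hp => Nat.prime_of_mem_primesBelow hp
  have hPq : ∀ p ∈ y.primesBelow, ¬ p ∣ q := fun p hp h => by
    have h1 := (Nat.prime_dvd_prime_iff_eq (hP p hp) Fact.out).mp h
    have h2 := Nat.lt_of_mem_primesBelow hp
    omega
  obtain ⟨K, hKP⟩ : ∃ K, K = ∏ p ∈ y.primesBelow, p := ⟨_, rfl⟩
  have hK0 : 0 < K := hKP ▸ Finset.prod_pos fun p hp => (hP p hp).pos
  have hK1 : (1 : ℝ) ≤ K := by exact_mod_cast hK0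
  have hKr : (K : ℝ) ≤ r := by
    have h1 : (K : ℝ) ≤ 4 ^ y := by
      rw [hKP]; exact_mod_cast prod_primesBelow_le_four_pow y
    have h2 : (4 : ℝ) ≤ Real.exp 2 := by
      have h3 : Real.exp 2 = Real.exp 1 ^ 2 := by rw [← Real.exp_nat_mul]; norm_num
      have := Real.add_one_le_exp (1 : ℝ)
      rw [h3]; nlinarith
    calc (K : ℝ) ≤ 4 ^ y := h1
      _ ≤ Real.exp 2 ^ y := by gcongr
      _ = Real.exp (y * 2) := by rw [← Real.exp_nat_mul]
      _ ≤ r := Real.exp_le_exp.mpr (by linarith)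
  have hrpow : ∀ n : ℕ, n ≠ 0 → 2 ≤ r ^ n := fun n hn => by
    have := le_self_pow₀ hr1 hn
    linarith
  obtain ⟨hJ, hJ'⟩ := floor_bounds (hrpow 56 (by norm_num))
  obtain ⟨hM, hM'⟩ := floor_bounds (hrpow 32 (by norm_num))
  set J := ⌊r ^ 56⌋₊
  set M := ⌊r ^ 32⌋₊
  have hJ0 : 0 < J := by
    have : (0 : ℝ) < J := lt_of_lt_of_le (by positivity) hJ
    exact_mod_cast this
  have hM0 : 0 < M := by
    have : (0 : ℝ) < M := lt_of_lt_of_le (by positivity) hM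
    exact_mod_cast this
  have hlt : ∀ m n : ℕ, m ≤ 56 → (n : ℝ) ≤ r ^ m → K * n < q := fun m n hm hn => by
    have : (K : ℝ) * n < q := by
      rw [hrq]
      calc (K : ℝ) * n ≤ r * r ^ 56 := by
            gcongr
            exact hn.trans (pow_le_pow_right₀ hr1 hm)
        _ = r ^ 57 := by ring
        _ < r ^ 64 := pow_lt_pow_right₀ (by linarith) (by norm_num)
    exact_mod_cast this
  have hKJ := hlt 56 J le_rfl hJ'
  have hKM := hlt 32 M (by norm_num) hM'
  have herr := error_terms_le hr hrq hK1 hKr hJ hJ' hM hM'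
  obtain ⟨j, hj, hge⟩ := exists_neg_re_charHat_prod_ge (q := q) (δ := 0.49) hJ0 hP hPq hKP hKJ
    fun e he => herr.trans (sum_powerset_ge hJ0 hM0 hP hKP hKJ hKM he)
  rw [Finset.mem_Icc] at hj
  have hKj0 : 0 < K * j := Nat.mul_pos hK0 hj.1
  have hKjq : K * j < q := (Nat.mul_le_mul_left K hj.2).trans_lt hKJ
  refine ⟨((K * j : ℕ) : ℤ), by omega, by omega, ?_⟩
  have hne : (((K * j : ℕ) : ℤ) : ZMod q) ≠ 0 := by
    rw [Int.cast_natCast, Ne, ZMod.natCast_eq_zero_iff]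
    exact Nat.not_dvd_of_pos_of_lt hKj0 hKjq
  have hC := le_Cfun hy3 hne
  rw [Int.cast_natCast] at hC
  have hprod := log_le_prod_primesBelow (by omega : 1 ≤ y)
  have hlogy : Real.log L - Real.log 256 ≤ Real.log y := by
    rw [← Real.log_div (by linarith) (by norm_num)]
    exact Real.log_le_log (by linarith) (by linarith)
  have htail : (2 + Real.log q) / 2 * Real.exp 8 * (Real.exp (8 / ((y : ℝ) - 1)) - 1) ≤
      4096 * Real.exp 8 := by
    have h1 : 8 / ((y : ℝ) - 1) ≤ 2048 / L := by
      rw [div_le_div_iff₀ (by linarith) (by linarith)]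
      linarith
    have h0 : 0 ≤ 8 / ((y : ℝ) - 1) := div_nonneg (by norm_num) (by linarith)
    have h2 : 2048 / L ≤ 1 := by rw [div_le_one (by linarith)]; linarith
    have h3 := Real.abs_exp_sub_one_le (x := 8 / ((y : ℝ) - 1))
      (by rw [abs_of_nonneg h0]; linarith)
    rw [abs_of_nonneg h0] at h3
    have h4 : Real.exp (8 / ((y : ℝ) - 1)) - 1 ≤ 4096 / L := by
      calc _ ≤ _ := le_abs_self _
        _ ≤ _ := h3
        _ ≤ 2 * (2048 / L) := by gcongr
        _ = _ := by ring
    have h5 : 0 < L := by linarith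
    calc (2 + L) / 2 * Real.exp 8 * (Real.exp (8 / ((y : ℝ) - 1)) - 1)
        ≤ L * Real.exp 8 * (4096 / L) := by
          gcongr
          · linarith [Real.add_one_le_exp (8 / ((y : ℝ) - 1))]
          · linarith
      _ = _ := by field_simp
  linarith

/-- Existence of large values of `C(k)` (Theorem 1, part 3). -/
theorem exists_large_value_C :
    ∀ ε : ℝ, 0 < ε → ∃ q₀ : ℕ, ∀ q : ℕ, q.Prime → q₀ ≤ q →
    ∃ k : ℤ, 1 ≤ k ∧ k ≤ (q : ℤ) - 1 ∧ -Cfun q (-k) = Cfun q k ∧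
      (Real.exp Real.eulerMascheroniConstant / 4 - ε) * Real.log (Real.log q) ≤ Cfun q k := by
  intro ε hε
  have hlog : Filter.Tendsto (fun q : ℕ => Real.log q) Filter.atTop Filter.atTop :=
    Real.tendsto_log_atTop.comp tendsto_natCast_atTop_atTop
  have hloglog := Real.tendsto_log_atTop.comp hlog
  have hev := (hlog.eventually_ge_atTop 1000000).and
    (hloglog.eventually_ge_atTop (1000 * (0.49 * Real.log 256 + 4096 * Real.exp 8)))
  obtain ⟨q₀, hq₀⟩ := Filter.eventually_atTop.mp hev
  refine ⟨q₀, fun q hq hqq => ?_⟩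
  have : Fact q.Prime := ⟨hq⟩
  obtain ⟨hL, hLL⟩ := hq₀ q hqq
  rw [Function.comp_apply] at hLL
  obtain ⟨k, hk1, hk2, hk⟩ := exists_Cfun_ge (q := q) hL
  refine ⟨k, hk1, hk2, by rw [Cfun_neg, neg_neg], le_trans ?_ hk⟩
  have h256 : 0 ≤ Real.log 256 := Real.log_nonneg (by norm_num)
  have hLL0 : 0 ≤ Real.log (Real.log q) := le_trans (by positivity) hLL
  have hγ := exp_eulerMascheroniConstant_le
  have h1 : (Real.exp Real.eulerMascheroniConstant / 4 - ε) * Real.log (Real.log q) ≤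
      0.487 * Real.log (Real.log q) :=
    mul_le_mul_of_nonneg_right (by linarith) hLL0
  linarith
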